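/- arXiv:2103.05272 — 18 statements merged into one kernel-verified Lean document; each statement's English description precedes it below -/
import Mathlib

section
/- Assume (S1). Then for all r_i, r_j, r_k > 0 the radicands ε_s r_s² + ε_t r_t² + 2η_st r_s r_t are positive (so l_ij, l_ik, l_jk are well-defined positive reals), the identity (l_ij+l_ik+l_jk)(l_ij+l_ik−l_jk)(l_ij−l_ik+l_jk)(−l_ij+l_ik+l_jk) = 4 r_i² r_j² r_k² Q^E holds, and consequently l_ij, l_ik, l_jk satisfy the three strict triangle inequalities if and only if Q^E > 0. -/
/-- Euclidean edge length `l_st = √(ε_s r_s² + ε_t r_t² + 2 η_st r_s r_t)`. -/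
noncomputable def lE (εs εt ηst rs rt : ℝ) : ℝ :=
  Real.sqrt (εs * rs ^ 2 + εt * rt ^ 2 + 2 * ηst * rs * rt)

/-- The quantity `Q^E` (with `κ_q = r_q⁻¹`, `γ`'s as in the paper). -/
noncomputable def QE (εi εj εk ηij ηik ηjk ri rj rk : ℝ) : ℝ :=
  (εj * εk - ηjk ^ 2) * ri⁻¹ ^ 2 + (εi * εk - ηik ^ 2) * rj⁻¹ ^ 2 +
    (εi * εj - ηij ^ 2) * rk⁻¹ ^ 2 +
    2 * (εk * ηij + ηik * ηjk) * ri⁻¹ * rj⁻¹ +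
    2 * (εj * ηik + ηij * ηjk) * ri⁻¹ * rk⁻¹ +
    2 * (εi * ηjk + ηij * ηik) * rj⁻¹ * rk⁻¹

theorem radicand_pos {ε δ η x y : ℝ} (hε : ε = 0 ∨ ε = 1) (hδ : δ = 0 ∨ δ = 1)
    (h : 0 < ε * δ + η) (hx : 0 < x) (hy : 0 < y) :
    0 < ε * x ^ 2 + δ * y ^ 2 + 2 * η * x * y := by
  have hsq : 0 ≤ (ε * x - δ * y) ^ 2 := sq_nonneg _
  have hpos : 0 < 2 * (ε * δ + η) * (x * y) := by positivity
  have hε' : ε ^ 2 = ε := by rcases hε with rfl | rfl <;> norm_num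
  have hδ' : δ ^ 2 = δ := by rcases hδ with rfl | rfl <;> norm_num
  have key : ε * x ^ 2 + δ * y ^ 2 + 2 * η * x * y =
      (ε * x - δ * y) ^ 2 + 2 * (ε * δ + η) * (x * y) := by
    linear_combination (-x ^ 2) * hε' - y ^ 2 * hδ'
  linarith

theorem triangle_inequalities_iff_heron_pos {a b c : ℝ} (ha : 0 < a) (hb : 0 < b) (hc : 0 < c) :
    (a < b + c ∧ b < a + c ∧ c < a + b) ↔
      0 < (a + b + c) * (a + b - c) * (a - b + c) * (-a + b + c) := by
  constructor
  · rintro ⟨h₁, h₂, h₃⟩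
    have h₁' : 0 < -a + b + c := by linarith
    have h₂' : 0 < a - b + c := by linarith
    have h₃' : 0 < a + b - c := by linarith
    positivity
  · intro h
    have hs : 0 < a + b + c := by positivity
    contrapose! h
    by_cases h₁ : a < b + c
    · by_cases h₂ : b < a + c
      · exact mul_nonpos_of_nonpos_of_nonneg
          (mul_nonpos_of_nonpos_of_nonneg
            (mul_nonpos_of_nonneg_of_nonpos hs.le (by linarith [h h₁ h₂])) (by linarith))
          (by linarith)
      · exact mul_nonpos_of_nonpos_of_nonneg
          (mul_nonpos_of_nonneg_of_nonpos
            (mul_nonneg hs.le (by linarith)) (by linarith)) (by linarith)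
    · exact mul_nonpos_of_nonneg_of_nonpos
        (mul_nonneg (mul_nonneg hs.le (by linarith)) (by linarith)) (by linarith)

theorem stmt0 (εi εj εk ηij ηik ηjk : ℝ)
    (hεi : εi = 0 ∨ εi = 1) (hεj : εj = 0 ∨ εj = 1) (hεk : εk = 0 ∨ εk = 1)
    (hS1ij : 0 < εi * εj + ηij) (hS1ik : 0 < εi * εk + ηik) (hS1jk : 0 < εj * εk + ηjk) :
    ∀ ri rj rk : ℝ, 0 < ri → 0 < rj → 0 < rk →
      (0 < εi * ri ^ 2 + εj * rj ^ 2 + 2 * ηij * ri * rj) ∧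
      (0 < εi * ri ^ 2 + εk * rk ^ 2 + 2 * ηik * ri * rk) ∧
      (0 < εj * rj ^ 2 + εk * rk ^ 2 + 2 * ηjk * rj * rk) ∧
      ((lE εi εj ηij ri rj + lE εi εk ηik ri rk + lE εj εk ηjk rj rk) *
          (lE εi εj ηij ri rj + lE εi εk ηik ri rk - lE εj εk ηjk rj rk) *
          (lE εi εj ηij ri rj - lE εi εk ηik ri rk + lE εj εk ηjk rj rk) *
          (-lE εi εj ηij ri rj + lE εi εk ηik ri rk + lE εj εk ηjk rj rk) =
        4 * ri ^ 2 * rj ^ 2 * rk ^ 2 * QE εi εj εk ηij ηik ηjk ri rj rk) ∧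
      ((lE εi εj ηij ri rj < lE εi εk ηik ri rk + lE εj εk ηjk rj rk ∧
          lE εi εk ηik ri rk < lE εi εj ηij ri rj + lE εj εk ηjk rj rk ∧
          lE εj εk ηjk rj rk < lE εi εj ηij ri rj + lE εi εk ηik ri rk) ↔
        0 < QE εi εj εk ηij ηik ηjk ri rj rk) := by
  intro ri rj rk hi hj hk
  have hij := radicand_pos hεi hεj hS1ij hi hj
  have hik := radicand_pos hεi hεk hS1ik hi hk
  have hjk := radicand_pos hεj hεk hS1jk hj hk
  have heron : (lE εi εj ηij ri rj + lE εi εk ηik ri rk + lE εj εk ηjk rj rk) *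
          (lE εi εj ηij ri rj + lE εi εk ηik ri rk - lE εj εk ηjk rj rk) *
          (lE εi εj ηij ri rj - lE εi εk ηik ri rk + lE εj εk ηjk rj rk) *
          (-lE εi εj ηij ri rj + lE εi εk ηik ri rk + lE εj εk ηjk rj rk) =
        4 * ri ^ 2 * rj ^ 2 * rk ^ 2 * QE εi εj εk ηij ηik ηjk ri rj rk := by
    have expand (a b c : ℝ) : (a + b + c) * (a + b - c) * (a - b + c) * (-a + b + c) =
        4 * a ^ 2 * b ^ 2 - (a ^ 2 + b ^ 2 - c ^ 2) ^ 2 := by ring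
    rw [expand]
    unfold lE QE
    rw [Real.sq_sqrt hij.le, Real.sq_sqrt hik.le, Real.sq_sqrt hjk.le]
    field_simp
    ring
  refine ⟨hij, hik, hjk, heron, ?_⟩
  have lij : 0 < lE εi εj ηij ri rj := Real.sqrt_pos.2 hij
  have lik : 0 < lE εi εk ηik ri rk := Real.sqrt_pos.2 hik
  have ljk : 0 < lE εj εk ηjk rj rk := Real.sqrt_pos.2 hjk
  rw [triangle_inequalities_iff_heron_pos lij lik ljk, heron]
  exact mul_pos_iff_of_pos_left (by positivity)
end

section
/- Assume (S1) and (S2). Then for every r_i, r_j, r_k > 0, no two of the quantities h_i, h_j, h_k are simultaneously nonpositive; that is, there is no pair {s,t} ⊆ {i,j,k} with h_s ≤ 0 and h_t ≤ 0. -/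
/-- `h_i = (ε_jε_k − η_jk²)κ_i + γ_k κ_j + γ_j κ_k` with `κ_q = r_q⁻¹`. -/
noncomputable def hVi (εi εj εk ηij ηik ηjk ri rj rk : ℝ) : ℝ :=
  (εj * εk - ηjk ^ 2) * ri⁻¹ + (εk * ηij + ηik * ηjk) * rj⁻¹ + (εj * ηik + ηij * ηjk) * rk⁻¹

/-- `h_j = (ε_iε_k − η_ik²)κ_j + γ_k κ_i + γ_i κ_k`. -/
noncomputable def hVj (εi εj εk ηij ηik ηjk ri rj rk : ℝ) : ℝ :=
  (εi * εk - ηik ^ 2) * rj⁻¹ + (εk * ηij + ηik * ηjk) * ri⁻¹ + (εi * ηjk + ηij * ηik) * rk⁻¹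

/-- `h_k = (ε_iε_j − η_ij²)κ_k + γ_j κ_i + γ_i κ_j`. -/
noncomputable def hVk (εi εj εk ηij ηik ηjk ri rj rk : ℝ) : ℝ :=
  (εi * εj - ηij ^ 2) * rk⁻¹ + (εj * ηik + ηij * ηjk) * ri⁻¹ + (εi * ηjk + ηij * ηik) * rj⁻¹

/-- The product of the diagonal coefficients dominates the square of the off-diagonal one when
both linear forms are nonpositive at a positive point. -/
theorem sq_le_mul_of_forms_nonpos {A B g x y : ℝ} (hg : 0 ≤ g) (hx : 0 < x) (hy : 0 < y)
    (h₁ : A * x + g * y ≤ 0) (h₂ : B * y + g * x ≤ 0) : g ^ 2 ≤ A * B := by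
  have h : (g * y) * (g * x) ≤ (-(A * x)) * (-(B * y)) :=
    mul_le_mul (by linarith) (by linarith) (by positivity)
      (le_trans (by positivity : 0 ≤ g * y) (by linarith))
  have hxy : 0 < x * y := mul_pos hx hy
  refine le_of_mul_le_mul_right ?_ hxy
  linarith

/-- If a linear form with a nonnegative off-diagonal coefficient is nonpositive at a positive
point, its diagonal coefficient is nonpositive. -/
theorem coeff_nonpos_of_form_nonpos {A g x y : ℝ} (hg : 0 ≤ g) (hx : 0 < x) (hy : 0 < y)
    (h : A * x + g * y ≤ 0) : A ≤ 0 := by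
  have := mul_nonneg hg hy.le
  by_contra! hA
  have := mul_pos hA hx
  linarith

/-- Under the structure conditions, `h_i` and `h_j` are not both nonpositive. Here `c = η_ij`,
`b = η_ik`, `a = η_jk`, and `x, y, z` are the curvatures. -/
theorem not_two_nonpos {p q r c b a x y z : ℝ}
    (hp : p = 0 ∨ p = 1) (hq : q = 0 ∨ q = 1) (hr : r = 0 ∨ r = 1)
    (hc : 0 < p * q + c) (hb : 0 < p * r + b) (ha : 0 < q * r + a)
    (hi : 0 ≤ p * a + c * b) (hj : 0 ≤ q * b + c * a) (hk : 0 ≤ r * c + b * a)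
    (hx : 0 < x) (hy : 0 < y) (hz : 0 < z)
    (h₁ : (q * r - a ^ 2) * x + (r * c + b * a) * y + (q * b + c * a) * z ≤ 0)
    (h₂ : (p * r - b ^ 2) * y + (r * c + b * a) * x + (p * a + c * b) * z ≤ 0) : False := by
  have hiz := mul_nonneg hi hz.le
  have hjz := mul_nonneg hj hz.le
  rcases hr with rfl | rfl
  · have ha' : 0 < a := by linarith
    have hb' : 0 < b := by linarith
    have hsum : (b * (q * b + c * a) + a * (p * a + c * b)) * z ≤ 0 := by
      linarith [mul_nonpos_of_nonneg_of_nonpos hb'.le h₁, mul_nonpos_of_nonneg_of_nonpos ha'.le h₂]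
    have hpos : 0 < b * (q * b + c * a) + a * (p * a + c * b) := by
      have hab := mul_pos ha' hb'
      rcases hp with rfl | rfl <;> rcases hq with rfl | rfl <;>
        nlinarith [mul_pos hab hc, sq_nonneg (a - b), sq_nonneg a, sq_nonneg b]
    exact absurd (mul_pos hpos hz) hsum.not_gt
  · have h₁' : (q * 1 - a ^ 2) * x + (1 * c + b * a) * y ≤ 0 := by linarith
    have h₂' : (p * 1 - b ^ 2) * y + (1 * c + b * a) * x ≤ 0 := by linarith
    have hA := coeff_nonpos_of_form_nonpos hk hx hy h₁'
    have hB := coeff_nonpos_of_form_nonpos hk hy hx h₂'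
    have hdet := sq_le_mul_of_forms_nonpos hk hx hy h₁' h₂'
    have ha' : 0 < a ∧ q ≤ a := by
      rcases hq with rfl | rfl
      · constructor <;> linarith
      · have : 1 ≤ a := by nlinarith
        constructor <;> linarith
    have hb' : 0 < b ∧ p ≤ b := by
      rcases hp with rfl | rfl
      · constructor <;> linarith
      · have : 1 ≤ b := by nlinarith
        constructor <;> linarith
    obtain ⟨ha0, haq⟩ := ha'
    obtain ⟨hb0, hbp⟩ := hb'
    have hab := mul_pos ha0 hb0
    have habc := mul_pos hab hc
    rcases hp with rfl | rfl <;> rcases hq with rfl | rfl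
    · nlinarith [sq_nonneg c]
    · nlinarith [sq_nonneg c, sq_nonneg b]
    · nlinarith [sq_nonneg c, sq_nonneg a]
    · have hab1 : 1 ≤ a * b := one_le_mul_of_one_le_of_one_le haq hbp
      have hc1 : 0 < 1 + c := by linarith
      nlinarith [sq_nonneg (a - b), mul_nonneg hc1.le (sub_nonneg.2 hab1), mul_pos hc1 hc1]

theorem stmt1 (εi εj εk ηij ηik ηjk : ℝ)
    (hεi : εi = 0 ∨ εi = 1) (hεj : εj = 0 ∨ εj = 1) (hεk : εk = 0 ∨ εk = 1)
    (hS1ij : 0 < εi * εj + ηij) (hS1ik : 0 < εi * εk + ηik) (hS1jk : 0 < εj * εk + ηjk)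
    (hS2i : 0 ≤ εi * ηjk + ηij * ηik) (hS2j : 0 ≤ εj * ηik + ηij * ηjk)
    (hS2k : 0 ≤ εk * ηij + ηik * ηjk)
    (ri rj rk : ℝ) (hri : 0 < ri) (hrj : 0 < rj) (hrk : 0 < rk) :
    ¬(hVi εi εj εk ηij ηik ηjk ri rj rk ≤ 0 ∧ hVj εi εj εk ηij ηik ηjk ri rj rk ≤ 0) ∧
    ¬(hVi εi εj εk ηij ηik ηjk ri rj rk ≤ 0 ∧ hVk εi εj εk ηij ηik ηjk ri rj rk ≤ 0) ∧
    ¬(hVj εi εj εk ηij ηik ηjk ri rj rk ≤ 0 ∧ hVk εi εj εk ηij ηik ηjk ri rj rk ≤ 0) := by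
  have hxi := inv_pos.2 hri
  have hxj := inv_pos.2 hrj
  have hxk := inv_pos.2 hrk
  unfold hVi hVj hVk
  refine ⟨fun ⟨h₁, h₂⟩ => ?_, fun ⟨h₁, h₂⟩ => ?_, fun ⟨h₁, h₂⟩ => ?_⟩
  · exact not_two_nonpos hεi hεj hεk hS1ij hS1ik hS1jk hS2i hS2j hS2k hxi hxj hxk h₁ h₂
  · exact not_two_nonpos (p := εi) (q := εk) (r := εj) (c := ηik) (b := ηij) (a := ηjk)
      hεi hεk hεj hS1ik hS1ij (by linarith) (by linarith) (by linarith) hS2j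
      hxi hxk hxj (by linarith) (by linarith)
  · exact not_two_nonpos (p := εj) (q := εk) (r := εi) (c := ηjk) (b := ηij) (a := ηik)
      hεj hεk hεi hS1jk (by linarith) (by linarith) (by linarith) (by linarith) (by linarith)
      hxj hxk hxi (by linarith) (by linarith)
end

section
/- Assume (S1) and (S2). If r_i, r_j, r_k > 0 satisfy Q^E ≤ 0 (i.e. the discrete conformal structure is degenerate), then exactly one of h_i, h_j, h_k is negative and the other two are positive. -/
/-- Two rows of the adjugate form cannot both be nonpositive on a positive vector `(x, y, z)`;
here `p = η_jk`, `q = η_ik`, `η = η_ij`. -/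
theorem not_both_rows_nonpos {εi εj εk η q p x y z : ℝ}
    (hεi : εi = 0 ∨ εi = 1) (hεj : εj = 0 ∨ εj = 1) (hεk : εk = 0 ∨ εk = 1)
    (hη : 0 < εi * εj + η) (hq : 0 < εi * εk + q) (hp : 0 < εj * εk + p)
    (ha : 0 ≤ εi * p + η * q) (hb : 0 ≤ εj * q + η * p) (hc : 0 ≤ εk * η + q * p)
    (hx : 0 < x) (hy : 0 < y) (hz : 0 < z)
    (hi : (εj * εk - p ^ 2) * x + (εk * η + q * p) * y + (εj * q + η * p) * z ≤ 0)
    (hj : (εi * εk - q ^ 2) * y + (εk * η + q * p) * x + (εi * p + η * q) * z ≤ 0) : False := by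
  have hbz := mul_nonneg hb hz.le
  have haz := mul_nonneg ha hz.le
  rcases hεk with rfl | rfl
  · simp only [mul_zero, zero_add, zero_mul, zero_sub] at *
    have hpq : q * y - p * x ≤ 0 := by
      by_contra! h
      nlinarith [mul_pos hp h]
    have hqp : p * x - q * y ≤ 0 := by
      by_contra! h
      nlinarith [mul_pos hq h]
    have heq : q * y = p * x := by linarith
    have hb0 : εj * q + η * p = 0 := by
      have : (εj * q + η * p) * z ≤ 0 := by linear_combination hi - p * heq
      exact le_antisymm (nonpos_of_mul_nonpos_left this hz) hb
    have ha0 : εi * p + η * q = 0 := by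
      have : (εi * p + η * q) * z ≤ 0 := by linear_combination hj + q * heq
      exact le_antisymm (nonpos_of_mul_nonpos_left this hz) ha
    rcases hεi with rfl | rfl
    · nlinarith [mul_pos (show 0 < η by linarith) hq]
    rcases hεj with rfl | rfl
    · nlinarith [mul_pos (show 0 < η by linarith) hp]
    · nlinarith [mul_pos (show 0 < 1 + η by linarith) hq, mul_pos (show 0 < 1 + η by linarith) hp]
  · simp only [mul_one, one_mul] at *
    have hA : (η + q * p) * y ≤ (p ^ 2 - εj) * x := by linarith
    have hB : (η + q * p) * x ≤ (q ^ 2 - εi) * y := by linarith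
    have hA0 : 0 ≤ p ^ 2 - εj :=
      nonneg_of_mul_nonneg_left ((mul_nonneg hc hy.le).trans hA) hx
    have hB0 : 0 ≤ q ^ 2 - εi :=
      nonneg_of_mul_nonneg_left ((mul_nonneg hc hx.le).trans hB) hy
    have hdet : (η + q * p) ^ 2 ≤ (p ^ 2 - εj) * (q ^ 2 - εi) := by
      have h := mul_le_mul hA hB (mul_nonneg hc hx.le) (mul_nonneg hA0 hx.le)
      refine le_of_mul_le_mul_right ?_ (mul_pos hx hy)
      linear_combination h
    have hp0 : 0 < p := by rcases hεj with rfl | rfl <;> nlinarith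
    have hq0 : 0 < q := by rcases hεi with rfl | rfl <;> nlinarith
    have hpq := mul_pos hq0 hp0
    rcases hεi with rfl | rfl <;> rcases hεj with rfl | rfl
    · nlinarith
    · nlinarith
    · nlinarith
    · have h1 : 1 ≤ p := by nlinarith
      have h2 : 1 ≤ q := by nlinarith
      nlinarith [sq_nonneg (p - q), mul_nonneg (sub_nonneg.2 h1) (sub_nonneg.2 h2)]

theorem stmt2 (εi εj εk ηij ηik ηjk : ℝ)
    (hεi : εi = 0 ∨ εi = 1) (hεj : εj = 0 ∨ εj = 1) (hεk : εk = 0 ∨ εk = 1)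
    (hS1ij : 0 < εi * εj + ηij) (hS1ik : 0 < εi * εk + ηik) (hS1jk : 0 < εj * εk + ηjk)
    (hS2i : 0 ≤ εi * ηjk + ηij * ηik) (hS2j : 0 ≤ εj * ηik + ηij * ηjk)
    (hS2k : 0 ≤ εk * ηij + ηik * ηjk)
    (ri rj rk : ℝ) (hri : 0 < ri) (hrj : 0 < rj) (hrk : 0 < rk)
    (hQ : QE εi εj εk ηij ηik ηjk ri rj rk ≤ 0) :
    (hVi εi εj εk ηij ηik ηjk ri rj rk < 0 ∧ 0 < hVj εi εj εk ηij ηik ηjk ri rj rk ∧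
        0 < hVk εi εj εk ηij ηik ηjk ri rj rk) ∨
    (hVj εi εj εk ηij ηik ηjk ri rj rk < 0 ∧ 0 < hVi εi εj εk ηij ηik ηjk ri rj rk ∧
        0 < hVk εi εj εk ηij ηik ηjk ri rj rk) ∨
    (hVk εi εj εk ηij ηik ηjk ri rj rk < 0 ∧ 0 < hVi εi εj εk ηij ηik ηjk ri rj rk ∧
        0 < hVj εi εj εk ηij ηik ηjk ri rj rk) := by
  have hx := inv_pos.2 hri
  have hy := inv_pos.2 hrj
  have hz := inv_pos.2 hrk
  have hij : ¬ (hVi εi εj εk ηij ηik ηjk ri rj rk ≤ 0 ∧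
      hVj εi εj εk ηij ηik ηjk ri rj rk ≤ 0) := fun ⟨hi, hj⟩ =>
    not_both_rows_nonpos hεi hεj hεk hS1ij hS1ik hS1jk hS2i hS2j hS2k hx hy hz hi hj
  have hik : ¬ (hVi εi εj εk ηij ηik ηjk ri rj rk ≤ 0 ∧
      hVk εi εj εk ηij ηik ηjk ri rj rk ≤ 0) := by
    rintro ⟨hi, hk⟩
    unfold hVi at hi
    unfold hVk at hk
    apply not_both_rows_nonpos (η := ηik) (q := ηij) (p := ηjk) (x := ri⁻¹) (y := rk⁻¹)
      (z := rj⁻¹) hεi hεk hεj <;> first | assumption | linarith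
  have hjk : ¬ (hVj εi εj εk ηij ηik ηjk ri rj rk ≤ 0 ∧
      hVk εi εj εk ηij ηik ηjk ri rj rk ≤ 0) := by
    rintro ⟨hj, hk⟩
    unfold hVj at hj
    unfold hVk at hk
    apply not_both_rows_nonpos (η := ηjk) (q := ηij) (p := ηik) (x := rj⁻¹) (y := rk⁻¹)
      (z := ri⁻¹) hεj hεk hεi <;> first | assumption | linarith
  have hsum : ri⁻¹ * hVi εi εj εk ηij ηik ηjk ri rj rk +
      rj⁻¹ * hVj εi εj εk ηij ηik ηjk ri rj rk +
      rk⁻¹ * hVk εi εj εk ηij ηik ηjk ri rj rk ≤ 0 := by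
    unfold QE at hQ
    unfold hVi hVj hVk
    linear_combination hQ
  generalize hVi εi εj εk ηij ηik ηjk ri rj rk = hi at *
  generalize hVj εi εj εk ηij ηik ηjk ri rj rk = hj at *
  generalize hVk εi εj εk ηij ηik ηjk ri rj rk = hk at *
  rcases lt_or_ge 0 hi with pi | ni
  · rcases lt_or_ge 0 hj with pj | nj
    · refine Or.inr (Or.inr ⟨?_, pi, pj⟩)
      by_contra! nk
      nlinarith [mul_pos hx pi, mul_pos hy pj, mul_nonneg hz.le nk]
    · have pk : 0 < hk := by
        by_contra! h
        exact hjk ⟨nj, h⟩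
      refine Or.inr (Or.inl ⟨?_, pi, pk⟩)
      by_contra! h
      nlinarith [mul_pos hx pi, mul_pos hz pk, mul_nonneg hy.le h]
  · have pj : 0 < hj := by
      by_contra! h
      exact hij ⟨ni, h⟩
    have pk : 0 < hk := by
      by_contra! h
      exact hik ⟨ni, h⟩
    refine Or.inl ⟨?_, pj, pk⟩
    by_contra! h
    nlinarith [mul_pos hy pj, mul_pos hz pk, mul_nonneg hx.le h]
end

section
/- Assume (S1) and (S2), and additionally that ε_jε_k − η_jk² ≥ 0, ε_iε_k − η_ik² ≥ 0 and ε_iε_j − η_ij² ≥ 0. Then Q^E > 0 for every r_i, r_j, r_k > 0; that is, every positive triple (r_i, r_j, r_k) is a nondegenerate Euclidean discrete conformal structure for the triangle. -/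
theorem stmt3 (εi εj εk ηij ηik ηjk : ℝ)
    (hεi : εi = 0 ∨ εi = 1) (hεj : εj = 0 ∨ εj = 1) (hεk : εk = 0 ∨ εk = 1)
    (hS1ij : 0 < εi * εj + ηij) (hS1ik : 0 < εi * εk + ηik) (hS1jk : 0 < εj * εk + ηjk)
    (hS2i : 0 ≤ εi * ηjk + ηij * ηik) (hS2j : 0 ≤ εj * ηik + ηij * ηjk)
    (hS2k : 0 ≤ εk * ηij + ηik * ηjk)
    (hAi : 0 ≤ εj * εk - ηjk ^ 2) (hAj : 0 ≤ εi * εk - ηik ^ 2)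
    (hAk : 0 ≤ εi * εj - ηij ^ 2) :
    ∀ ri rj rk : ℝ, 0 < ri → 0 < rj → 0 < rk →
      0 < QE εi εj εk ηij ηik ηjk ri rj rk := by
  intro ri rj rk hri hrj hrk
  obtain rfl : εi = 1 := hεi.resolve_left fun h => by subst h; nlinarith
  obtain rfl : εj = 1 := hεj.resolve_left fun h => by subst h; nlinarith
  obtain rfl : εk = 1 := hεk.resolve_left fun h => by subst h; nlinarith
  have hi := inv_pos.mpr hri
  have hj := inv_pos.mpr hrj
  have hk := inv_pos.mpr hrk
  unfold QE
  generalize ri⁻¹ = a at *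
  generalize rj⁻¹ = b at *
  generalize rk⁻¹ = c at *
  have hAi' := mul_nonneg hAi (sq_nonneg a)
  have hAj' := mul_nonneg hAj (sq_nonneg b)
  have hAk' := mul_nonneg hAk (sq_nonneg c)
  have hγk := mul_nonneg hS2k (mul_pos hi hj).le
  have hγj := mul_nonneg hS2j (mul_pos hi hk).le
  have hγi := mul_nonneg hS2i (mul_pos hj hk).le
  rcases hAi.lt_or_eq with h | h
  · linarith [mul_pos h (pow_pos hi 2)]
  rcases hAj.lt_or_eq with h' | h'
  · linarith [mul_pos h' (pow_pos hj 2)]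
  have hjk : ηjk = 1 := by nlinarith
  have hik : ηik = 1 := by nlinarith
  subst hjk hik
  linarith [mul_pos (show 0 < 1 * ηij + 1 * 1 by linarith) (mul_pos hi hj)]
end

section
/- Assume (S1). Then for all r_i, r_j, r_k > 0 the identity Δ_i = 4(ε_jκ_k² + ε_kκ_j² + 2η_jkκ_jκ_k)·G holds, and if A_i = η_jk² − ε_jε_k > 0 then Δ_i > 0. -/
/-- If `a > 1` and `b, c > -1`, then `a² + b² + c² + 2abc > 1`. -/
theorem one_lt_sq_add_sq_add_sq_add_two_mul {a b c : ℝ} (ha : 1 < a) (hb : -1 < b) (hc : -1 < c) :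
    1 < a ^ 2 + b ^ 2 + c ^ 2 + 2 * c * b * a := by
  have ha' : 0 < a ^ 2 - 1 := by nlinarith
  rcases lt_or_ge b 1 with hb1 | hb1
  · have h : 0 < (a ^ 2 - 1) * (1 - b ^ 2) := mul_pos ha' (by nlinarith)
    nlinarith [sq_nonneg (c + a * b)]
  · rcases lt_or_ge c 1 with hc1 | hc1
    · have h : 0 < (a ^ 2 - 1) * (1 - c ^ 2) := mul_pos ha' (by nlinarith)
      nlinarith [sq_nonneg (b + a * c)]
    · have h : 0 < c * b * a := by positivity
      nlinarith [sq_nonneg b, sq_nonneg c]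

/-- If `a, c > 0` and `b > -1`, then `a² + c² + 2abc > 0`. -/
theorem sq_add_sq_add_two_mul_pos {a b c : ℝ} (ha : 0 < a) (hb : -1 < b) (hc : 0 < c) :
    0 < a ^ 2 + c ^ 2 + 2 * c * b * a := by
  have h : 0 < c * a * (b + 1) := mul_pos (mul_pos hc ha) (by linarith)
  nlinarith [sq_nonneg (a - c)]

theorem stmt4 (εi εj εk ηij ηik ηjk : ℝ)
    (hεi : εi = 0 ∨ εi = 1) (hεj : εj = 0 ∨ εj = 1) (hεk : εk = 0 ∨ εk = 1)
    (hS1ij : 0 < εi * εj + ηij) (hS1ik : 0 < εi * εk + ηik) (hS1jk : 0 < εj * εk + ηjk) :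
    ∀ ri rj rk : ℝ, 0 < ri → 0 < rj → 0 < rk →
      ((-2 * ((εk * ηij + ηik * ηjk) * rj⁻¹ + (εj * ηik + ηij * ηjk) * rk⁻¹)) ^ 2 -
          4 * (ηjk ^ 2 - εj * εk) *
            ((ηik ^ 2 - εi * εk) * rj⁻¹ ^ 2 + (ηij ^ 2 - εi * εj) * rk⁻¹ ^ 2 -
              2 * (εi * ηjk + ηij * ηik) * rj⁻¹ * rk⁻¹) =
        4 * (εj * rk⁻¹ ^ 2 + εk * rj⁻¹ ^ 2 + 2 * ηjk * rj⁻¹ * rk⁻¹) *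
          (εi * ηjk ^ 2 + εj * ηik ^ 2 + εk * ηij ^ 2 + 2 * ηij * ηik * ηjk - εi * εj * εk)) ∧
      (0 < ηjk ^ 2 - εj * εk →
        0 < (-2 * ((εk * ηij + ηik * ηjk) * rj⁻¹ + (εj * ηik + ηij * ηjk) * rk⁻¹)) ^ 2 -
          4 * (ηjk ^ 2 - εj * εk) *
            ((ηik ^ 2 - εi * εk) * rj⁻¹ ^ 2 + (ηij ^ 2 - εi * εj) * rk⁻¹ ^ 2 -
              2 * (εi * ηjk + ηij * ηik) * rj⁻¹ * rk⁻¹)) := by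
  intro ri rj rk hri hrj hrk
  have hj : 0 < rj⁻¹ := inv_pos.mpr hrj
  have hk : 0 < rk⁻¹ := inv_pos.mpr hrk
  generalize rj⁻¹ = x at *
  generalize rk⁻¹ = y at *
  refine (and_iff_left_of_imp fun hΔ hA => ?_).mpr (by ring)
  rw [hΔ]
  have hjk : εj * εk < ηjk := by
    rcases hεj with rfl | rfl <;> rcases hεk with rfl | rfl <;> nlinarith
  have hεj0 : 0 ≤ εj := by rcases hεj with rfl | rfl <;> norm_num
  have hεk0 : 0 ≤ εk := by rcases hεk with rfl | rfl <;> norm_num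
  have hη : 0 < ηjk := (mul_nonneg hεj0 hεk0).trans_lt hjk
  refine mul_pos (by positivity) ?_
  rcases hεi with rfl | rfl
  · have hij : 0 < ηij := by linarith
    have hik : 0 < ηik := by linarith
    have h : 0 < εj * ηik ^ 2 + εk * ηij ^ 2 + 2 * ηij * ηik * ηjk := by positivity
    linarith
  · rcases hεj with rfl | rfl <;> rcases hεk with rfl | rfl
    · have hij : 0 < ηij := by linarith
      have hik : 0 < ηik := by linarith
      have h : 0 < ηjk ^ 2 + 2 * ηij * ηik * ηjk := by positivity
      linarith
    · linarith [sq_add_sq_add_two_mul_pos (a := ηjk) (b := ηik) (c := ηij) hη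
        (by linarith) (by linarith)]
    · linarith [sq_add_sq_add_two_mul_pos (a := ηjk) (b := ηij) (c := ηik) hη
        (by linarith) (by linarith)]
    · linarith [one_lt_sq_add_sq_add_sq_add_two_mul (a := ηjk) (b := ηik) (c := ηij)
        (by linarith) (by linarith) (by linarith)]
end

section
/- Assume (S1). If at least one of the quantities η_jk² − ε_jε_k, η_ik² − ε_iε_k, η_ij² − ε_iε_j is positive, then G > 0. -/
/-- The case where all three weights are one. -/
lemma sq_add_sq_add_sq_add_two_mul_sub_one_pos {x y z : ℝ} (hx : -1 < x) (hy : -1 < y)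
    (hz : -1 < z) (h : 0 < x ^ 2 - 1) : 0 < x ^ 2 + y ^ 2 + z ^ 2 + 2 * x * y * z - 1 := by
  have hx1 : 1 < x := by nlinarith
  rcases lt_or_ge z 1 with hz1 | hz1
  · have hz2 : 0 < 1 - z ^ 2 := by nlinarith
    nlinarith [sq_nonneg (y + x * z), mul_pos h hz2]
  · have hxz : 0 ≤ x * z - 1 := by nlinarith
    have hlt : (x * z - 1) ^ 2 < (y + x * z) ^ 2 := pow_lt_pow_left₀ (by linarith) hxz two_ne_zero
    nlinarith [sq_nonneg (x - z)]

/-- The case where exactly one weight vanishes. -/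
lemma sq_add_sq_add_two_mul_pos_s5 {x y z : ℝ} (hx : -1 < x) (hy : 0 < y) (hz : 0 < z) :
    0 < y ^ 2 + z ^ 2 + 2 * x * y * z := by
  have hyz : 0 < (1 + x) * (y * z) := mul_pos (by linarith) (mul_pos hy hz)
  nlinarith [sq_nonneg (y - z)]

theorem stmt5 (εi εj εk ηij ηik ηjk : ℝ)
    (hεi : εi = 0 ∨ εi = 1) (hεj : εj = 0 ∨ εj = 1) (hεk : εk = 0 ∨ εk = 1)
    (hS1ij : 0 < εi * εj + ηij) (hS1ik : 0 < εi * εk + ηik) (hS1jk : 0 < εj * εk + ηjk)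
    (hpos : 0 < ηjk ^ 2 - εj * εk ∨ 0 < ηik ^ 2 - εi * εk ∨ 0 < ηij ^ 2 - εi * εj) :
    0 < εi * ηjk ^ 2 + εj * ηik ^ 2 + εk * ηij ^ 2 + 2 * ηij * ηik * ηjk - εi * εj * εk := by
  rcases hεi with rfl | rfl <;> rcases hεj with rfl | rfl <;> rcases hεk with rfl | rfl <;>
    simp only [zero_mul, mul_zero, one_mul, zero_add, add_zero, sub_zero]
      at hS1ij hS1ik hS1jk hpos ⊢
  · positivity
  · positivity
  · positivity
  · linarith [sq_add_sq_add_two_mul_pos_s5 (x := ηjk) (by linarith) hS1ij hS1ik]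
  · positivity
  · linarith [sq_add_sq_add_two_mul_pos_s5 (x := ηik) (by linarith) hS1ij hS1jk]
  · linarith [sq_add_sq_add_two_mul_pos_s5 (x := ηij) (by linarith) hS1ik hS1jk]
  · have hij : -1 < ηij := by linarith
    have hik : -1 < ηik := by linarith
    have hjk : -1 < ηjk := by linarith
    rcases hpos with h | h | h
    · linarith [sq_add_sq_add_sq_add_two_mul_sub_one_pos hjk hik hij h]
    · linarith [sq_add_sq_add_sq_add_two_mul_sub_one_pos hik hjk hij h]
    · linarith [sq_add_sq_add_sq_add_two_mul_sub_one_pos hij hik hjk h]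
end

section
/- Assume (S1) and (S2). Then for r_i, r_j, r_k > 0 one has Q^E ≤ 0 if and only if there exists an index q ∈ {i,j,k} such that A_q > 0 and κ_q ≥ (−B_q + √Δ_q)/(2A_q). (This gives the explicit description of the admissible space: the nondegenerate Euclidean discrete conformal structures are exactly the complement in ℝ³_{>0} of the union of the regions V_q = {κ_q ≥ (−B_q + √Δ_q)/(2A_q)} over those q with A_q > 0.) -/
noncomputable def AEi (εi εj εk ηij ηik ηjk : ℝ) : ℝ := ηjk ^ 2 - εj * εk

noncomputable def BEi (εi εj εk ηij ηik ηjk ri rj rk : ℝ) : ℝ :=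
  -2 * ((εk * ηij + ηik * ηjk) * rj⁻¹ + (εj * ηik + ηij * ηjk) * rk⁻¹)

noncomputable def CEi (εi εj εk ηij ηik ηjk ri rj rk : ℝ) : ℝ :=
  (ηik ^ 2 - εi * εk) * rj⁻¹ ^ 2 + (ηij ^ 2 - εi * εj) * rk⁻¹ ^ 2 -
    2 * (εi * ηjk + ηij * ηik) * rj⁻¹ * rk⁻¹

/-- `Δ_i = B_i² − 4 A_i C_i`. -/
noncomputable def DeltaEi (εi εj εk ηij ηik ηjk ri rj rk : ℝ) : ℝ :=
  BEi εi εj εk ηij ηik ηjk ri rj rk ^ 2 -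
    4 * AEi εi εj εk ηij ηik ηjk * CEi εi εj εk ηij ηik ηjk ri rj rk

/-- Region `V_i`: `A_i > 0` and `κ_i ≥ (−B_i + √Δ_i)/(2A_i)`. -/
noncomputable def VEi (εi εj εk ηij ηik ηjk ri rj rk : ℝ) : Prop :=
  0 < AEi εi εj εk ηij ηik ηjk ∧
    (-BEi εi εj εk ηij ηik ηjk ri rj rk + Real.sqrt (DeltaEi εi εj εk ηij ηik ηjk ri rj rk)) /
        (2 * AEi εi εj εk ηij ηik ηjk) ≤ ri⁻¹

theorem quadratic_largerRoot_le_iff {a b c x : ℝ} (ha : 0 < a) :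
    (-b + Real.sqrt (b ^ 2 - 4 * a * c)) / (2 * a) ≤ x ↔
      0 ≤ 2 * a * x + b ∧ 0 ≤ a * x ^ 2 + b * x + c := by
  rw [div_le_iff₀ (by positivity), neg_add_le_iff_le_add, Real.sqrt_le_iff]
  have key : (b + x * (2 * a)) ^ 2 - (b ^ 2 - 4 * a * c) = 4 * a * (a * x ^ 2 + b * x + c) := by
    ring
  refine and_congr (by rw [show b + x * (2 * a) = 2 * a * x + b by ring]) ?_
  rw [← sub_nonneg, key]
  exact mul_nonneg_iff_of_pos_left (by positivity)

/-- Half of the derivative of `-Q^E` with respect to `κ_i`. -/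
noncomputable def halfSlope (εi εj εk ηij ηik ηjk ri rj rk : ℝ) : ℝ :=
  AEi εi εj εk ηij ηik ηjk * ri⁻¹ - (εk * ηij + ηik * ηjk) * rj⁻¹ -
    (εj * ηik + ηij * ηjk) * rk⁻¹

theorem vEi_iff (εi εj εk ηij ηik ηjk ri rj rk : ℝ) :
    VEi εi εj εk ηij ηik ηjk ri rj rk ↔
      0 < AEi εi εj εk ηij ηik ηjk ∧ 0 ≤ halfSlope εi εj εk ηij ηik ηjk ri rj rk ∧
        QE εi εj εk ηij ηik ηjk ri rj rk ≤ 0 := by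
  unfold VEi DeltaEi
  refine and_congr_right fun hA => ?_
  rw [quadratic_largerRoot_le_iff hA]
  have hslope : 2 * AEi εi εj εk ηij ηik ηjk * ri⁻¹ + BEi εi εj εk ηij ηik ηjk ri rj rk =
      2 * halfSlope εi εj εk ηij ηik ηjk ri rj rk := by
    unfold halfSlope BEi
    ring
  have hQ : AEi εi εj εk ηij ηik ηjk * ri⁻¹ ^ 2 + BEi εi εj εk ηij ηik ηjk ri rj rk * ri⁻¹ +
      CEi εi εj εk ηij ηik ηjk ri rj rk = -QE εi εj εk ηij ηik ηjk ri rj rk := by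
    unfold AEi BEi CEi QE
    ring
  rw [hslope, hQ, neg_nonneg, mul_nonneg_iff_of_pos_left two_pos]

theorem qE_rotate (εi εj εk ηij ηik ηjk ri rj rk : ℝ) :
    QE εj εk εi ηjk ηij ηik rj rk ri = QE εi εj εk ηij ηik ηjk ri rj rk := by
  unfold QE
  ring

theorem halfSlope_sum (εi εj εk ηij ηik ηjk ri rj rk : ℝ) :
    ri⁻¹ * halfSlope εi εj εk ηij ηik ηjk ri rj rk +
      rj⁻¹ * halfSlope εj εk εi ηjk ηij ηik rj rk ri +
      rk⁻¹ * halfSlope εk εi εj ηik ηjk ηij rk ri rj = -QE εi εj εk ηij ηik ηjk ri rj rk := by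
  unfold halfSlope AEi QE
  ring

theorem halfSlope_nonpos {εi εj εk ηij ηik ηjk ri rj rk : ℝ}
    (hri : 0 < ri) (hrj : 0 < rj) (hrk : 0 < rk)
    (hj : 0 ≤ εj * ηik + ηij * ηjk) (hk : 0 ≤ εk * ηij + ηik * ηjk)
    (hA : 0 < AEi εi εj εk ηij ηik ηjk → halfSlope εi εj εk ηij ηik ηjk ri rj rk < 0) :
    halfSlope εi εj εk ηij ηik ηjk ri rj rk ≤ 0 := by
  rcases lt_or_ge 0 (AEi εi εj εk ηij ηik ηjk) with h | h
  · exact (hA h).le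
  · unfold halfSlope
    have h₁ := mul_nonpos_of_nonpos_of_nonneg h (inv_pos.2 hri).le
    have h₂ := mul_nonneg hk (inv_pos.2 hrj).le
    have h₃ := mul_nonneg hj (inv_pos.2 hrk).le
    linarith

theorem AEi_nonneg_of_halfSlope_nonneg {εi εj εk ηij ηik ηjk ri rj rk : ℝ}
    (hri : 0 < ri) (hrj : 0 < rj) (hrk : 0 < rk)
    (hj : 0 ≤ εj * ηik + ηij * ηjk) (hk : 0 ≤ εk * ηij + ηik * ηjk)
    (h : 0 ≤ halfSlope εi εj εk ηij ηik ηjk ri rj rk) :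
    0 ≤ AEi εi εj εk ηij ηik ηjk := by
  unfold halfSlope at h
  have h₂ := mul_nonneg hk (inv_pos.2 hrj).le
  have h₃ := mul_nonneg hj (inv_pos.2 hrk).le
  exact nonneg_of_mul_nonneg_left (b := ri⁻¹) (by linarith) (inv_pos.2 hri)

theorem eq_one_of_sq_eq_mul {ε ε' η : ℝ} (hε : ε = 0 ∨ ε = 1) (hε' : ε' = 0 ∨ ε' = 1)
    (hpos : 0 < ε * ε' + η) (h : η ^ 2 = ε * ε') : ε = 1 ∧ ε' = 1 ∧ η = 1 := by
  rcases hε with rfl | rfl <;> rcases hε' with rfl | rfl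
  on_goal 4 => exact ⟨rfl, rfl, by nlinarith⟩
  all_goals nlinarith

theorem stmt6 (εi εj εk ηij ηik ηjk : ℝ)
    (hεi : εi = 0 ∨ εi = 1) (hεj : εj = 0 ∨ εj = 1) (hεk : εk = 0 ∨ εk = 1)
    (hS1ij : 0 < εi * εj + ηij) (hS1ik : 0 < εi * εk + ηik) (hS1jk : 0 < εj * εk + ηjk)
    (hS2i : 0 ≤ εi * ηjk + ηij * ηik) (hS2j : 0 ≤ εj * ηik + ηij * ηjk)
    (hS2k : 0 ≤ εk * ηij + ηik * ηjk)
    (ri rj rk : ℝ) (hri : 0 < ri) (hrj : 0 < rj) (hrk : 0 < rk) :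
    QE εi εj εk ηij ηik ηjk ri rj rk ≤ 0 ↔
      (VEi εi εj εk ηij ηik ηjk ri rj rk ∨
        VEi εj εk εi ηjk ηij ηik rj rk ri ∨
        VEi εk εi εj ηik ηjk ηij rk ri rj) := by
  have hrot := qE_rotate εi εj εk ηij ηik ηjk ri rj rk
  have hrot' := (qE_rotate εk εi εj ηik ηjk ηij rk ri rj).symm
  simp only [vEi_iff, hrot, hrot']
  constructor
  · intro hQ
    simp only [hQ, and_true]
    by_contra! ⟨hi, hj, hk⟩
    have hsum := halfSlope_sum εi εj εk ηij ηik ηjk ri rj rk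
    have gi := halfSlope_nonpos hri hrj hrk hS2j hS2k hi
    have gj := halfSlope_nonpos (εi := εj) (εj := εk) (εk := εi) (ηij := ηjk) (ηik := ηij)
      (ηjk := ηik) hrj hrk hri (by linarith) (by linarith) hj
    have gk := halfSlope_nonpos (εi := εk) (εj := εi) (εk := εj) (ηij := ηik) (ηik := ηjk)
      (ηjk := ηij) hrk hri hrj (by linarith) (by linarith) hk
    have pi := mul_nonpos_of_nonneg_of_nonpos (inv_pos.2 hri).le gi
    have pj := mul_nonpos_of_nonneg_of_nonpos (inv_pos.2 hrj).le gj
    have pk := mul_nonpos_of_nonneg_of_nonpos (inv_pos.2 hrk).le gk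
    have gi' : 0 ≤ halfSlope εi εj εk ηij ηik ηjk ri rj rk :=
      nonneg_of_mul_nonneg_right (by linarith) (inv_pos.2 hri)
    have gj' : 0 ≤ halfSlope εj εk εi ηjk ηij ηik rj rk ri :=
      nonneg_of_mul_nonneg_right (by linarith) (inv_pos.2 hrj)
    have gk' : 0 ≤ halfSlope εk εi εj ηik ηjk ηij rk ri rj :=
      nonneg_of_mul_nonneg_right (by linarith) (inv_pos.2 hrk)
    have Ai := AEi_nonneg_of_halfSlope_nonneg hri hrj hrk hS2j hS2k gi'
    have Aj := AEi_nonneg_of_halfSlope_nonneg hrj hrk hri (by linarith) (by linarith) gj'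
    have Ak := AEi_nonneg_of_halfSlope_nonneg hrk hri hrj (by linarith) (by linarith) gk'
    have Ai' := not_lt.1 fun h => (hi h).not_ge gi'
    have Aj' := not_lt.1 fun h => (hj h).not_ge gj'
    have Ak' := not_lt.1 fun h => (hk h).not_ge gk'
    unfold AEi at Ai Ai' Aj Aj' Ak Ak'
    obtain ⟨rfl, rfl, rfl⟩ := eq_one_of_sq_eq_mul hεj hεk hS1jk (by linarith)
    obtain ⟨rfl, -, rfl⟩ := eq_one_of_sq_eq_mul hεi hεj hS1ij (by linarith)
    obtain ⟨-, -, rfl⟩ := eq_one_of_sq_eq_mul hεi hεk hS1ik (by linarith)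
    unfold halfSlope AEi at gi'
    have := inv_pos.2 hrj
    have := inv_pos.2 hrk
    linarith
  · rintro (⟨-, -, h⟩ | ⟨-, -, h⟩ | ⟨-, -, h⟩) <;> exact h
end

section
/- Assume (S1) and (S2). Then for r_i, r_j, r_k > 0 there do not exist two distinct indices q ≠ q' in {i,j,k} with A_q > 0, A_{q'} > 0, κ_q ≥ (−B_q + √Δ_q)/(2A_q) and κ_{q'} ≥ (−B_{q'} + √Δ_{q'})/(2A_{q'}); that is, the regions V_q = {κ_q ≥ (−B_q + √Δ_q)/(2A_q)} (for indices q with A_q > 0) are pairwise disjoint. -/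
/-- Membership in `V_i` puts `κ_i` to the right of the vertex `−B_i / (2A_i)`. -/
theorem VEi.pos_and_vertex_le {εi εj εk ηij ηik ηjk ri rj rk : ℝ}
    (h : VEi εi εj εk ηij ηik ηjk ri rj rk) :
    0 < ηjk ^ 2 - εj * εk ∧
      (εk * ηij + ηik * ηjk) * rj⁻¹ + (εj * ηik + ηij * ηjk) * rk⁻¹ ≤
        (ηjk ^ 2 - εj * εk) * ri⁻¹ := by
  obtain ⟨hA, h⟩ := h
  refine ⟨hA, ?_⟩
  rw [div_le_iff₀ (by positivity)] at h
  have hs := Real.sqrt_nonneg (DeltaEi εi εj εk ηij ηik ηjk ri rj rk)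
  simp only [AEi, BEi] at h
  linarith

/-- The linear inequalities `γ_k y + γ_j z ≤ A_i x` and `γ_k x + γ_i z ≤ A_j y`, with
`a = η_ij`, `b = η_ik`, `c = η_jk`, are incompatible under the structure conditions. -/
theorem not_both_right_of_vertex {εi εj εk a b c x y z : ℝ}
    (hεi : εi = 0 ∨ εi = 1) (hεj : εj = 0 ∨ εj = 1) (hεk : εk = 0 ∨ εk = 1)
    (ha : 0 < εi * εj + a) (hb : 0 < εi * εk + b) (hc : 0 < εj * εk + c)
    (hγi : 0 ≤ εi * c + a * b) (hγj : 0 ≤ εj * b + a * c) (hγk : 0 ≤ εk * a + b * c)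
    (hx : 0 < x) (hy : 0 < y) (hz : 0 < z)
    (hAi : 0 < c ^ 2 - εj * εk) (hAj : 0 < b ^ 2 - εi * εk)
    (hVi : (εk * a + b * c) * y + (εj * b + a * c) * z ≤ (c ^ 2 - εj * εk) * x)
    (hVj : (εk * a + b * c) * x + (εi * c + a * b) * z ≤ (b ^ 2 - εi * εk) * y) : False := by
  have hi : (εk * a + b * c) * y ≤ (c ^ 2 - εj * εk) * x := by
    linarith [mul_nonneg hγj hz.le]
  have hj : (εk * a + b * c) * x ≤ (b ^ 2 - εi * εk) * y := by
    linarith [mul_nonneg hγi hz.le]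
  have hsq : (εk * a + b * c) ^ 2 ≤ (c ^ 2 - εj * εk) * (b ^ 2 - εi * εk) := by
    have h := mul_le_mul hi hj (by positivity) (by positivity)
    refine le_of_mul_le_mul_right ?_ (mul_pos hx hy)
    linarith
  rcases hεk with rfl | rfl
  · have hb' : 0 < b := by linarith
    have hc' : 0 < c := by linarith
    have hi' : b * y + (εj * b + a * c) * z / c ≤ c * x := by
      refine le_of_mul_le_mul_left ?_ hc'
      field_simp
      linarith
    have hj' : c * x + (εi * c + a * b) * z / b ≤ b * y := by
      refine le_of_mul_le_mul_left ?_ hb'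
      field_simp
      linarith
    have hpi : 0 ≤ (εi * c + a * b) * z / b := by positivity
    have hpj : 0 ≤ (εj * b + a * c) * z / c := by positivity
    have hγi0 : εi * c + a * b = 0 := by
      have h : (εi * c + a * b) * z / b = 0 := by linarith
      simpa [hz.ne', hb'.ne'] using h
    have hγj0 : εj * b + a * c = 0 := by
      have h : (εj * b + a * c) * z / c = 0 := by linarith
      simpa [hz.ne', hc'.ne'] using h
    rcases hεi with rfl | rfl <;> rcases hεj with rfl | rfl <;> nlinarith [mul_pos hb' hc']
  · rcases hεi with rfl | rfl <;> rcases hεj with rfl | rfl <;>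
      simp only [mul_one, one_mul, mul_zero, zero_mul, zero_add, sub_zero] at *
    · nlinarith [mul_pos ha ha, mul_pos ha (mul_pos hb hc)]
    · nlinarith [mul_pos ha ha, mul_pos ha (mul_pos hb (by nlinarith : 0 < c)), mul_pos hb hb]
    · nlinarith [mul_pos ha ha, mul_pos ha (mul_pos (by nlinarith : 0 < b) hc), mul_pos hc hc]
    · have hb1 : 1 < b := by nlinarith
      have hc1 : 1 < c := by nlinarith
      have hbc : 0 < b * c - 1 := by nlinarith
      nlinarith [sq_nonneg (b - c), mul_pos ha hbc, mul_pos ha ha]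

theorem stmt7 (εi εj εk ηij ηik ηjk : ℝ)
    (hεi : εi = 0 ∨ εi = 1) (hεj : εj = 0 ∨ εj = 1) (hεk : εk = 0 ∨ εk = 1)
    (hS1ij : 0 < εi * εj + ηij) (hS1ik : 0 < εi * εk + ηik) (hS1jk : 0 < εj * εk + ηjk)
    (hS2i : 0 ≤ εi * ηjk + ηij * ηik) (hS2j : 0 ≤ εj * ηik + ηij * ηjk)
    (hS2k : 0 ≤ εk * ηij + ηik * ηjk)
    (ri rj rk : ℝ) (hri : 0 < ri) (hrj : 0 < rj) (hrk : 0 < rk) :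
    ¬(VEi εi εj εk ηij ηik ηjk ri rj rk ∧ VEi εj εk εi ηjk ηij ηik rj rk ri) ∧
    ¬(VEi εi εj εk ηij ηik ηjk ri rj rk ∧ VEi εk εi εj ηik ηjk ηij rk ri rj) ∧
    ¬(VEi εj εk εi ηjk ηij ηik rj rk ri ∧ VEi εk εi εj ηik ηjk ηij rk ri rj) := by
  have hi := inv_pos.2 hri
  have hj := inv_pos.2 hrj
  have hk := inv_pos.2 hrk
  refine ⟨?_, ?_, ?_⟩ <;> rintro ⟨h₁, h₂⟩ <;>
    obtain ⟨hA₁, hV₁⟩ := h₁.pos_and_vertex_le <;>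
    obtain ⟨hA₂, hV₂⟩ := h₂.pos_and_vertex_le
  · exact not_both_right_of_vertex hεi hεj hεk hS1ij hS1ik hS1jk hS2i hS2j hS2k hi hj hk
      (by linarith) (by linarith) (by linarith) (by linarith)
  · exact not_both_right_of_vertex (a := ηik) (b := ηij) (c := ηjk) hεi hεk hεj
      (by linarith) (by linarith) (by linarith) (by linarith) (by linarith) (by linarith) hi hk hj
      (by linarith) (by linarith) (by linarith) (by linarith)
  · exact not_both_right_of_vertex (a := ηjk) (b := ηij) (c := ηik) hεj hεk hεi
      (by linarith) (by linarith) (by linarith) (by linarith) (by linarith) (by linarith) hj hk hi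
      (by linarith) (by linarith) (by linarith) (by linarith)
end

section
/- For any fixed ε_i, ε_j, ε_k ∈ {0,1}, the parameter set Γ = {(η_ij, η_ik, η_jk) ∈ ℝ³ : (S1) and (S2) hold} is a connected subset of ℝ³ (indeed any point of Γ can be joined to the octant where all three η's are nonnegative by a path inside Γ). -/
/-- If the product inequality holds at `(a, b, c)` and at most one entry is negative, then it holds
along the segment from `(1, 1, 1)` to `(a, b, c)`. -/
theorem nonneg_add_mul_segment_one {ε a b c s t : ℝ} (hε : ε = 0 ∨ ε = 1)
    (hs : 0 ≤ s) (ht : 0 ≤ t) (hst : s + t = 1) (ha : -ε ≤ a) (hb : -ε ≤ b) (hc : -1 ≤ c)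
    (h : 0 ≤ ε * c + a * b)
    (hab : ¬ (a < 0 ∧ b < 0)) (hac : ¬ (a < 0 ∧ c < 0)) (hbc : ¬ (b < 0 ∧ c < 0)) :
    0 ≤ ε * (s + t * c) + (s + t * a) * (s + t * b) := by
  obtain rfl : s = 1 - t := by linarith
  have ht1 : t ≤ 1 := by linarith
  rcases hε with rfl | rfl
  · have ha' : 0 ≤ a := by linarith
    have hb' : 0 ≤ b := by linarith
    have := mul_nonneg (add_nonneg hs (mul_nonneg ht ha')) (add_nonneg hs (mul_nonneg ht hb'))
    linarith
  · have sign : (0 ≤ a ∧ 0 ≤ b) ∨ (0 ≤ a ∧ 0 ≤ c) ∨ (0 ≤ b ∧ 0 ≤ c) := by grind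
    rcases sign with ⟨ha', hb'⟩ | ⟨ha', hc'⟩ | ⟨hb', hc'⟩
    · nlinarith [mul_nonneg (mul_nonneg hs ht) ha', mul_nonneg (mul_nonneg hs ht) hb',
        mul_nonneg (mul_nonneg ht ht) h, mul_nonneg (mul_nonneg hs ht) (neg_le_iff_add_nonneg.1 hc)]
    · nlinarith [mul_nonneg (mul_nonneg hs ht) ha', mul_nonneg (mul_nonneg hs ht) hc',
        mul_nonneg (mul_nonneg ht ht) h, mul_nonneg (mul_nonneg hs ht) (neg_le_iff_add_nonneg.1 hb)]
    · nlinarith [mul_nonneg (mul_nonneg hs ht) hb', mul_nonneg (mul_nonneg hs ht) hc',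
        mul_nonneg (mul_nonneg ht ht) h, mul_nonneg (mul_nonneg hs ht) (neg_le_iff_add_nonneg.1 ha)]

/-- Two negative entries are incompatible with the structure conditions. -/
theorem not_neg_and_neg {x y z a b c : ℝ} (hx : x = 0 ∨ x = 1) (hy : y = 0 ∨ y = 1)
    (hz : z = 0 ∨ z = 1) (ha : 0 < x * y + a) (hb : 0 < x * z + b)
    (h₂ : 0 ≤ y * b + a * c) (h₃ : 0 ≤ z * a + b * c) (h₁ : 0 ≤ x * c + a * b) :
    ¬ (a < 0 ∧ b < 0) := by
  rintro ⟨ha', hb'⟩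
  rcases hx with rfl | rfl
  · linarith
  rcases hy with rfl | rfl
  · linarith
  rcases hz with rfl | rfl
  · linarith
  have hc : c < 0 := by
    by_contra! hc
    nlinarith [mul_nonneg (neg_nonneg.2 ha'.le) hc]
  nlinarith [mul_pos_of_neg_of_neg ha' hb', mul_pos_of_neg_of_neg ha' hc,
    mul_pos_of_neg_of_neg hb' hc]

theorem stmt8 (εi εj εk : ℝ)
    (hεi : εi = 0 ∨ εi = 1) (hεj : εj = 0 ∨ εj = 1) (hεk : εk = 0 ∨ εk = 1) :
    IsConnected {p : ℝ × ℝ × ℝ |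
      (0 < εi * εj + p.1 ∧ 0 < εi * εk + p.2.1 ∧ 0 < εj * εk + p.2.2) ∧
      (0 ≤ εi * p.2.2 + p.1 * p.2.1 ∧ 0 ≤ εj * p.2.1 + p.1 * p.2.2 ∧
        0 ≤ εk * p.1 + p.2.1 * p.2.2)} := by
  have bound : ∀ {u v : ℝ}, (u = 0 ∨ u = 1) → (v = 0 ∨ v = 1) →
      0 ≤ u * v ∧ u * v ≤ u ∧ u * v ≤ v ∧ u * v ≤ 1 := by
    rintro u v (rfl | rfl) (rfl | rfl) <;> norm_num
  obtain ⟨ij₀, iji, ijj, ij₁⟩ := bound hεi hεj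
  obtain ⟨ik₀, iki, ikk, ik₁⟩ := bound hεi hεk
  obtain ⟨jk₀, jkj, jkk, jk₁⟩ := bound hεj hεk
  have pos : ∀ {w a s t : ℝ}, 0 ≤ w → 0 ≤ s → 0 ≤ t → s + t = 1 → 0 < w + a →
      0 < w + (s + t * a) := by
    intro w a s t hw hs ht hst h
    rcases hs.eq_or_lt with rfl | hs
    · obtain rfl : t = 1 := by linarith
      linarith
    · obtain rfl : s = 1 - t := by linarith
      nlinarith [mul_nonneg ht h.le, mul_nonneg hs.le hw]
  refine (StarConvex.isPathConnected (a := ((1 : ℝ), (1 : ℝ), (1 : ℝ))) ?_ ?_).isConnected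
  · rintro ⟨a, b, c⟩ ⟨⟨ha, hb, hc⟩, h₁, h₂, h₃⟩ s t hs ht hst
    dsimp only at ha hb hc h₁ h₂ h₃
    have hab := not_neg_and_neg hεi hεj hεk ha hb h₂ h₃ h₁
    rw [mul_comm εi εj] at ha
    have hac := not_neg_and_neg hεj hεi hεk ha hc h₁ (by rwa [mul_comm c b]) h₂
    rw [mul_comm εi εk] at hb
    rw [mul_comm εj εk] at hc
    have hbc := not_neg_and_neg hεk hεi hεj hb hc (by rwa [mul_comm b a]) (by rwa [mul_comm c a]) h₃
    rw [mul_comm εj εi] at ha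
    rw [mul_comm εk εi] at hb
    rw [mul_comm εk εj] at hc
    simp only [Set.mem_ofPred_eq, Prod.smul_mk, Prod.mk_add_mk, smul_eq_mul, mul_one]
    refine ⟨⟨pos ij₀ hs ht hst ha, pos ik₀ hs ht hst hb, pos jk₀ hs ht hst hc⟩, ?_, ?_, ?_⟩
    · exact nonneg_add_mul_segment_one hεi hs ht hst (by linarith only [iji, ha])
        (by linarith only [iki, hb]) (by linarith only [jk₁, hc]) h₁
        hab hac hbc
    · exact nonneg_add_mul_segment_one hεj hs ht hst (by linarith only [ijj, ha])
        (by linarith only [jkj, hc]) (by linarith only [ik₁, hb]) h₂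
        hac hab (mt And.symm hbc)
    · exact nonneg_add_mul_segment_one hεk hs ht hst (by linarith only [ikk, hb])
        (by linarith only [jkk, hc]) (by linarith only [ij₁, ha]) h₃
        hbc (mt And.symm hab) (mt And.symm hac)
  · rcases hεi with rfl | rfl <;> rcases hεj with rfl | rfl <;> rcases hεk with rfl | rfl <;>
      norm_num
end

section
/- Assume (S1) and (S2), and let (r_i, r_j, r_k) > 0 satisfy Q^E > 0, so that l_ij, l_ik, l_jk form a nondegenerate Euclidean triangle. Regard the inner angle θ_i = arccos((l_ij² + l_ik² − l_jk²)/(2 l_ij l_ik)) (and analogously θ_j, θ_k) as a function of (u_i, u_j, u_k) ∈ ℝ³ via r_q = e^{u_q}. Then θ_i is differentiable and ∂θ_i/∂u_j = ∂θ_j/∂u_i = r_i² r_j² r_k h_k / (A l_ij²), where A = l_ij l_ik sin θ_i; moreover ∂θ_i/∂u_i = −∂θ_i/∂u_j − ∂θ_i/∂u_k. -/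
/-- Euclidean edge length as a function of the logarithmic coordinates `a, b`
(`r_s = e^a`, `r_t = e^b`). -/
noncomputable def lEu (εs εt ηst a b : ℝ) : ℝ :=
  Real.sqrt (εs * Real.exp a ^ 2 + εt * Real.exp b ^ 2 + 2 * ηst * Real.exp a * Real.exp b)

/-- The inner angle at the first vertex of the Euclidean triangle, via the cosine law,
as a function of the logarithmic coordinates `(a, b, c)` of the three vertices. -/
noncomputable def thetaEu (ε1 ε2 ε3 η12 η13 η23 a b c : ℝ) : ℝ :=
  Real.arccos ((lEu ε1 ε2 η12 a b ^ 2 + lEu ε1 ε3 η13 a c ^ 2 - lEu ε2 ε3 η23 b c ^ 2) /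
    (2 * lEu ε1 ε2 η12 a b * lEu ε1 ε3 η13 a c))

/-- The common value `r_i² r_j² r_k h_k / (A l_ij²)` with `A = l_ij l_ik sin θ_i`. -/
noncomputable def DEu (εi εj εk ηij ηik ηjk ui uj uk : ℝ) : ℝ :=
  Real.exp ui ^ 2 * Real.exp uj ^ 2 * Real.exp uk *
      ((εi * εj - ηij ^ 2) * (Real.exp uk)⁻¹ + (εj * ηik + ηij * ηjk) * (Real.exp ui)⁻¹ +
        (εi * ηjk + ηij * ηik) * (Real.exp uj)⁻¹) /
    (lEu εi εj ηij ui uj * lEu εi εk ηik ui uk *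
        Real.sin (thetaEu εi εj εk ηij ηik ηjk ui uj uk) * lEu εi εj ηij ui uj ^ 2)

/-- The squared Euclidean edge length. -/
noncomputable def lSqEu (εs εt ηst a b : ℝ) : ℝ :=
  εs * Real.exp a ^ 2 + εt * Real.exp b ^ 2 + 2 * ηst * Real.exp a * Real.exp b

theorem lSqEu_comm (εs εt ηst a b : ℝ) : lSqEu εs εt ηst a b = lSqEu εt εs ηst b a := by
  unfold lSqEu; ring

theorem lEu_eq_sqrt (εs εt ηst a b : ℝ) : lEu εs εt ηst a b = √(lSqEu εs εt ηst a b) := rfl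

theorem lSqEu_pos {εs εt ηst : ℝ} (hs : εs = 0 ∨ εs = 1) (ht : εt = 0 ∨ εt = 1)
    (h : 0 < εs * εt + ηst) (a b : ℝ) : 0 < lSqEu εs εt ηst a b := by
  have ha := Real.exp_pos a
  have hb := Real.exp_pos b
  have key : 0 < (εs * εt + ηst) * (Real.exp a * Real.exp b) := by positivity
  unfold lSqEu
  rcases hs with rfl | rfl <;> rcases ht with rfl | rfl <;>
    nlinarith [sq_nonneg (Real.exp a - Real.exp b), sq_nonneg (Real.exp a), sq_nonneg (Real.exp b)]

theorem hasDerivAt_lSqEu_left (εs εt ηst a b : ℝ) :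
    HasDerivAt (fun t => lSqEu εs εt ηst t b)
      (2 * εs * Real.exp a ^ 2 + 2 * ηst * Real.exp a * Real.exp b) a := by
  have h := Real.hasDerivAt_exp a
  have := (((h.pow 2).const_mul εs).add_const (εt * Real.exp b ^ 2)).add
    ((h.const_mul (2 * ηst)).mul_const (Real.exp b))
  refine this.congr_deriv ?_
  push_cast
  ring

theorem hasDerivAt_lSqEu_right (εs εt ηst a b : ℝ) :
    HasDerivAt (fun t => lSqEu εs εt ηst a t)
      (2 * εt * Real.exp b ^ 2 + 2 * ηst * Real.exp a * Real.exp b) b := by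
  simp_rw [lSqEu_comm εs εt ηst a]
  exact (hasDerivAt_lSqEu_left εt εs ηst b a).congr_deriv (by ring)

/-- Heron's formula: four times the squared doubled area, in terms of `QE`. -/
theorem heron_eq_QE (εi εj εk ηij ηik ηjk a b c : ℝ) :
    4 * lSqEu εi εj ηij a b * lSqEu εi εk ηik a c -
        (lSqEu εi εj ηij a b + lSqEu εi εk ηik a c - lSqEu εj εk ηjk b c) ^ 2 =
      4 * (Real.exp a * Real.exp b * Real.exp c) ^ 2 *
        QE εi εj εk ηij ηik ηjk (Real.exp a) (Real.exp b) (Real.exp c) := by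
  have ha := (Real.exp_pos a).ne'
  have hb := (Real.exp_pos b).ne'
  have hc := (Real.exp_pos c).ne'
  unfold lSqEu QE
  field_simp
  ring

theorem sq_cosine_lt_one {P R N : ℝ} (hP : 0 < P) (hR : 0 < R) (hD : 0 < 4 * P * R - N ^ 2) :
    (N / (2 * √P * √R)) ^ 2 < 1 := by
  rw [div_pow, mul_pow, mul_pow, Real.sq_sqrt hP.le, Real.sq_sqrt hR.le,
    div_lt_one (by positivity)]
  linarith

theorem two_mul_sqrt_mul_sqrt_mul_sin {P R N : ℝ} (hP : 0 < P) (hR : 0 < R) :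
    2 * √P * √R * √(1 - (N / (2 * √P * √R)) ^ 2) = √(4 * P * R - N ^ 2) := by
  have hp := Real.sqrt_pos.2 hP
  have hr := Real.sqrt_pos.2 hR
  have h : 4 * P * R - N ^ 2 = (2 * √P * √R) ^ 2 * (1 - (N / (2 * √P * √R)) ^ 2) := by
    field_simp
    rw [Real.sq_sqrt hP.le, Real.sq_sqrt hR.le]
    ring
  rw [h, Real.sqrt_mul (by positivity), Real.sqrt_sq (by positivity)]

/-- Derivative of the angle given by the law of cosines, `P`, `R` and `S` being the squared edge
lengths. -/
theorem hasDerivAt_arccos_cosine {P R S : ℝ → ℝ} {P' R' S' t : ℝ} (hP : HasDerivAt P P' t)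
    (hR : HasDerivAt R R' t) (hS : HasDerivAt S S' t) (hP0 : 0 < P t) (hR0 : 0 < R t)
    (hD : 0 < 4 * P t * R t - (P t + R t - S t) ^ 2) :
    HasDerivAt (fun x => Real.arccos ((P x + R x - S x) / (2 * √(P x) * √(R x))))
      (((P t + R t - S t) * (P' / (2 * P t) + R' / (2 * R t)) - (P' + R' - S')) /
        √(4 * P t * R t - (P t + R t - S t) ^ 2)) t := by
  have hp := Real.sqrt_pos.2 hP0
  have hr := Real.sqrt_pos.2 hR0
  have hlt := sq_cosine_lt_one hP0 hR0 hD
  have hx := ((hP.add hR).sub hS).div (((hP.sqrt hP0.ne').const_mul 2).mul (hR.sqrt hR0.ne'))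
    (by simp only [Pi.mul_apply]; positivity)
  have := (Real.hasDerivAt_arccos (x := (P t + R t - S t) / (2 * √(P t) * √(R t)))
    (by intro h; rw [h] at hlt; norm_num at hlt)
    (by intro h; rw [h] at hlt; norm_num at hlt)).comp t hx
  refine this.congr_deriv ?_
  have hs : 0 < √(1 - ((P t + R t - S t) / (2 * √(P t) * √(R t))) ^ 2) :=
    Real.sqrt_pos.2 (by linarith)
  rw [← two_mul_sqrt_mul_sqrt_mul_sin hP0 hR0]
  generalize √(1 - ((P t + R t - S t) / (2 * √(P t) * √(R t))) ^ 2) = s at hs ⊢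
  have h1 := Real.sq_sqrt hP0.le
  have h2 := Real.sq_sqrt hR0.le
  simp only [Pi.add_apply, Pi.sub_apply, Pi.mul_apply]
  generalize √(P t) = p at *
  generalize √(R t) = r at *
  rw [← h1, ← h2]
  field_simp
  ring

section Triangle

variable {ε1 ε2 ε3 η12 η13 η23 : ℝ}

theorem thetaEu_eq (h12 : ∀ a b, 0 < lSqEu ε1 ε2 η12 a b) (h13 : ∀ a c, 0 < lSqEu ε1 ε3 η13 a c)
    (h23 : ∀ b c, 0 < lSqEu ε2 ε3 η23 b c) (a b c : ℝ) :
    thetaEu ε1 ε2 ε3 η12 η13 η23 a b c =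
      Real.arccos ((lSqEu ε1 ε2 η12 a b + lSqEu ε1 ε3 η13 a c - lSqEu ε2 ε3 η23 b c) /
        (2 * √(lSqEu ε1 ε2 η12 a b) * √(lSqEu ε1 ε3 η13 a c))) := by
  simp only [thetaEu, lEu_eq_sqrt, Real.sq_sqrt (h12 _ _).le, Real.sq_sqrt (h13 _ _).le,
    Real.sq_sqrt (h23 _ _).le]

theorem differentiableAt_thetaEu (h12 : ∀ a b, 0 < lSqEu ε1 ε2 η12 a b)
    (h13 : ∀ a c, 0 < lSqEu ε1 ε3 η13 a c) (h23 : ∀ b c, 0 < lSqEu ε2 ε3 η23 b c) {a b c : ℝ}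
    (hD : 0 < 4 * lSqEu ε1 ε2 η12 a b * lSqEu ε1 ε3 η13 a c -
      (lSqEu ε1 ε2 η12 a b + lSqEu ε1 ε3 η13 a c - lSqEu ε2 ε3 η23 b c) ^ 2) :
    DifferentiableAt ℝ
      (fun p : ℝ × ℝ × ℝ => thetaEu ε1 ε2 ε3 η12 η13 η23 p.1 p.2.1 p.2.2) (a, b, c) := by
  have hlt := sq_cosine_lt_one (h12 a b) (h13 a c) hD
  have hp := Real.sqrt_pos.2 (h12 a b)
  have hr := Real.sqrt_pos.2 (h13 a c)
  simp_rw [thetaEu_eq h12 h13 h23, div_eq_mul_inv]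
  have d12 : DifferentiableAt ℝ (fun p : ℝ × ℝ × ℝ => lSqEu ε1 ε2 η12 p.1 p.2.1) (a, b, c) := by
    unfold lSqEu; fun_prop
  have d13 : DifferentiableAt ℝ (fun p : ℝ × ℝ × ℝ => lSqEu ε1 ε3 η13 p.1 p.2.2) (a, b, c) := by
    unfold lSqEu; fun_prop
  have d23 : DifferentiableAt ℝ (fun p : ℝ × ℝ × ℝ => lSqEu ε2 ε3 η23 p.2.1 p.2.2) (a, b, c) := by
    unfold lSqEu; fun_prop
  have hden := ((d12.sqrt (h12 a b).ne').const_mul 2).mul (d13.sqrt (h13 a c).ne')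
  have hquot := ((d12.add d13).sub d23).mul (hden.inv (mul_pos (mul_pos two_pos hp) hr).ne')
  refine DifferentiableAt.comp (g := Real.arccos) (a, b, c) ?_ hquot
  refine Real.differentiableAt_arccos.2 ⟨?_, ?_⟩ <;>
  · intro h
    simp only [← div_eq_mul_inv] at h
    rw [h] at hlt
    norm_num at hlt

theorem DEu_eq (h12 : ∀ a b, 0 < lSqEu ε1 ε2 η12 a b) (h13 : ∀ a c, 0 < lSqEu ε1 ε3 η13 a c)
    (h23 : ∀ b c, 0 < lSqEu ε2 ε3 η23 b c) (a b c : ℝ) :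
    DEu ε1 ε2 ε3 η12 η13 η23 a b c =
      2 * Real.exp a * Real.exp b * ((ε1 * ε2 - η12 ^ 2) * Real.exp a * Real.exp b +
          (ε2 * η13 + η12 * η23) * Real.exp b * Real.exp c +
          (ε1 * η23 + η12 * η13) * Real.exp a * Real.exp c) /
        (√(4 * lSqEu ε1 ε2 η12 a b * lSqEu ε1 ε3 η13 a c -
          (lSqEu ε1 ε2 η12 a b + lSqEu ε1 ε3 η13 a c - lSqEu ε2 ε3 η23 b c) ^ 2) *
          lSqEu ε1 ε2 η12 a b) := by
  rw [DEu, thetaEu_eq h12 h13 h23, Real.sin_arccos, ← two_mul_sqrt_mul_sqrt_mul_sin (h12 a b) (h13 a c),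
    lEu_eq_sqrt, lEu_eq_sqrt, Real.sq_sqrt (h12 a b).le,
    ← mul_div_mul_left _ (_ * _ * _ * _) (two_ne_zero (α := ℝ))]
  have ha := (Real.exp_pos a).ne'
  have hb := (Real.exp_pos b).ne'
  have hc := (Real.exp_pos c).ne'
  congr 1
  · field_simp
  · ring

theorem hasDerivAt_thetaEu_snd (h12 : ∀ a b, 0 < lSqEu ε1 ε2 η12 a b)
    (h13 : ∀ a c, 0 < lSqEu ε1 ε3 η13 a c) (h23 : ∀ b c, 0 < lSqEu ε2 ε3 η23 b c) {a b c : ℝ}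
    (hD : 0 < 4 * lSqEu ε1 ε2 η12 a b * lSqEu ε1 ε3 η13 a c -
      (lSqEu ε1 ε2 η12 a b + lSqEu ε1 ε3 η13 a c - lSqEu ε2 ε3 η23 b c) ^ 2) :
    HasDerivAt (fun t => thetaEu ε1 ε2 ε3 η12 η13 η23 a t c)
      (DEu ε1 ε2 ε3 η12 η13 η23 a b c) b := by
  simp_rw [thetaEu_eq h12 h13 h23]
  refine (hasDerivAt_arccos_cosine (hasDerivAt_lSqEu_right ε1 ε2 η12 a b)
    (hasDerivAt_const b (lSqEu ε1 ε3 η13 a c)) (hasDerivAt_lSqEu_left ε2 ε3 η23 b c)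
    (h12 a b) (h13 a c) hD).congr_deriv ?_
  rw [DEu_eq h12 h13 h23]
  have hw := (Real.sqrt_pos.2 hD).ne'
  generalize √(_ - _) = w at hw ⊢
  have hP := (h12 a b).ne'
  rw [zero_div, add_zero]
  field_simp
  unfold lSqEu
  ring

theorem thetaEu_swap (ε1 ε2 ε3 η12 η13 η23 a b c : ℝ) :
    thetaEu ε1 ε2 ε3 η12 η13 η23 a b c = thetaEu ε1 ε3 ε2 η13 η12 η23 a c b := by
  have : lEu ε2 ε3 η23 b c = lEu ε3 ε2 η23 c b := by
    rw [lEu_eq_sqrt, lSqEu_comm, ← lEu_eq_sqrt]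
  unfold thetaEu
  rw [this]
  ring_nf

theorem DEu_comm (h12 : ∀ a b, 0 < lSqEu ε1 ε2 η12 a b) (h13 : ∀ a c, 0 < lSqEu ε1 ε3 η13 a c)
    (h23 : ∀ b c, 0 < lSqEu ε2 ε3 η23 b c) (a b c : ℝ) :
    DEu ε2 ε1 ε3 η12 η23 η13 b a c = DEu ε1 ε2 ε3 η12 η13 η23 a b c := by
  have h21 : ∀ b a, 0 < lSqEu ε2 ε1 η12 b a := fun b a => lSqEu_comm ε1 ε2 η12 a b ▸ h12 a b
  rw [DEu_eq h12 h13 h23, DEu_eq h21 h23 h13, lSqEu_comm ε2 ε1]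
  ring_nf

theorem hasDerivAt_thetaEu_fst (h12 : ∀ a b, 0 < lSqEu ε1 ε2 η12 a b)
    (h13 : ∀ a c, 0 < lSqEu ε1 ε3 η13 a c) (h23 : ∀ b c, 0 < lSqEu ε2 ε3 η23 b c) {a b c : ℝ}
    (hD : 0 < 4 * lSqEu ε1 ε2 η12 a b * lSqEu ε1 ε3 η13 a c -
      (lSqEu ε1 ε2 η12 a b + lSqEu ε1 ε3 η13 a c - lSqEu ε2 ε3 η23 b c) ^ 2) :
    HasDerivAt (fun t => thetaEu ε1 ε2 ε3 η12 η13 η23 t b c)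
      (-(DEu ε1 ε2 ε3 η12 η13 η23 a b c + DEu ε1 ε3 ε2 η13 η12 η23 a c b)) a := by
  have h32 : ∀ c b, 0 < lSqEu ε3 ε2 η23 c b := fun c b => lSqEu_comm ε2 ε3 η23 b c ▸ h23 b c
  rw [DEu_eq h12 h13 h23, DEu_eq h13 h12 h32]
  simp_rw [thetaEu_eq h12 h13 h23]
  refine (hasDerivAt_arccos_cosine (hasDerivAt_lSqEu_left ε1 ε2 η12 a b)
    (hasDerivAt_lSqEu_left ε1 ε3 η13 a c) (hasDerivAt_const a (lSqEu ε2 ε3 η23 b c))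
    (h12 a b) (h13 a c) hD).congr_deriv ?_
  have hheron : 4 * lSqEu ε1 ε3 η13 a c * lSqEu ε1 ε2 η12 a b -
      (lSqEu ε1 ε3 η13 a c + lSqEu ε1 ε2 η12 a b - lSqEu ε3 ε2 η23 c b) ^ 2 =
      4 * lSqEu ε1 ε2 η12 a b * lSqEu ε1 ε3 η13 a c -
      (lSqEu ε1 ε2 η12 a b + lSqEu ε1 ε3 η13 a c - lSqEu ε2 ε3 η23 b c) ^ 2 := by
    rw [lSqEu_comm ε3 ε2]; ring
  rw [hheron]
  have hw := (Real.sqrt_pos.2 hD).ne'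
  generalize √(_ - _) = w at hw ⊢
  have hP := (h12 a b).ne'
  have hR := (h13 a c).ne'
  field_simp
  unfold lSqEu
  ring

end Triangle

theorem stmt9 (εi εj εk ηij ηik ηjk : ℝ)
    (hεi : εi = 0 ∨ εi = 1) (hεj : εj = 0 ∨ εj = 1) (hεk : εk = 0 ∨ εk = 1)
    (hS1ij : 0 < εi * εj + ηij) (hS1ik : 0 < εi * εk + ηik) (hS1jk : 0 < εj * εk + ηjk)
    (hS2i : 0 ≤ εi * ηjk + ηij * ηik) (hS2j : 0 ≤ εj * ηik + ηij * ηjk)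
    (hS2k : 0 ≤ εk * ηij + ηik * ηjk)
    (ui uj uk : ℝ)
    (hQ : 0 < QE εi εj εk ηij ηik ηjk (Real.exp ui) (Real.exp uj) (Real.exp uk)) :
    DifferentiableAt ℝ
        (fun p : ℝ × ℝ × ℝ => thetaEu εi εj εk ηij ηik ηjk p.1 p.2.1 p.2.2) (ui, uj, uk) ∧
    HasDerivAt (fun t => thetaEu εi εj εk ηij ηik ηjk ui t uk)
        (DEu εi εj εk ηij ηik ηjk ui uj uk) uj ∧
    HasDerivAt (fun t => thetaEu εj εi εk ηij ηjk ηik uj t uk)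
        (DEu εi εj εk ηij ηik ηjk ui uj uk) ui ∧
    ∃ Dik : ℝ,
      HasDerivAt (fun t => thetaEu εi εj εk ηij ηik ηjk ui uj t) Dik uk ∧
      HasDerivAt (fun t => thetaEu εi εj εk ηij ηik ηjk t uj uk)
        (-(DEu εi εj εk ηij ηik ηjk ui uj uk + Dik)) ui := by
  have h12 := lSqEu_pos hεi hεj hS1ij
  have h13 := lSqEu_pos hεi hεk hS1ik
  have h23 := lSqEu_pos hεj hεk hS1jk
  have h21 := lSqEu_pos hεj hεi (mul_comm εi εj ▸ hS1ij)
  have h32 := lSqEu_pos hεk hεj (mul_comm εj εk ▸ hS1jk)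
  have hD : 0 < 4 * lSqEu εi εj ηij ui uj * lSqEu εi εk ηik ui uk -
      (lSqEu εi εj ηij ui uj + lSqEu εi εk ηik ui uk - lSqEu εj εk ηjk uj uk) ^ 2 := by
    rw [heron_eq_QE]; positivity
  refine ⟨differentiableAt_thetaEu h12 h13 h23 hD, hasDerivAt_thetaEu_snd h12 h13 h23 hD, ?_,
    DEu εi εk εj ηik ηij ηjk ui uk uj, ?_, hasDerivAt_thetaEu_fst h12 h13 h23 hD⟩
  · rw [← DEu_comm h12 h13 h23]
    refine hasDerivAt_thetaEu_snd h21 h23 h13 ?_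
    rw [lSqEu_comm εj εi]
    linarith
  · simp_rw [thetaEu_swap εi εj εk]
    refine hasDerivAt_thetaEu_snd h13 h12 h32 ?_
    rw [lSqEu_comm εk εj]
    linarith
end

section
/- Assume (S1) and (S2). Then for all r_i, r_j, r_k > 0 the determinant of the 3×3 matrix with rows (0, ε_j r_j + η_jk r_k, ε_k r_k + η_jk r_j), (ε_i r_i + η_ik r_k, 0, ε_k r_k + η_ik r_i), (ε_i r_i + η_ij r_j, ε_j r_j + η_ij r_i, 0) is at least 2 r_i r_j r_k (ε_iε_j + η_ij)(ε_iε_k + η_ik)(ε_jε_k + η_jk), and in particular is positive. (Consequently the Jacobian ∂(l_jk, l_ik, l_ij)/∂(u_i, u_j, u_k) of the Euclidean edge lengths with respect to u_q = log r_q is nonsingular.) -/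
open Matrix in
theorem stmt10 (εi εj εk ηij ηik ηjk : ℝ)
    (hεi : εi = 0 ∨ εi = 1) (hεj : εj = 0 ∨ εj = 1) (hεk : εk = 0 ∨ εk = 1)
    (hS1ij : 0 < εi * εj + ηij) (hS1ik : 0 < εi * εk + ηik) (hS1jk : 0 < εj * εk + ηjk)
    (hS2i : 0 ≤ εi * ηjk + ηij * ηik) (hS2j : 0 ≤ εj * ηik + ηij * ηjk)
    (hS2k : 0 ≤ εk * ηij + ηik * ηjk) :
    ∀ ri rj rk : ℝ, 0 < ri → 0 < rj → 0 < rk →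
      2 * ri * rj * rk * (εi * εj + ηij) * (εi * εk + ηik) * (εj * εk + ηjk) ≤
        Matrix.det !![0, εj * rj + ηjk * rk, εk * rk + ηjk * rj;
                      εi * ri + ηik * rk, 0, εk * rk + ηik * ri;
                      εi * ri + ηij * rj, εj * rj + ηij * ri, 0] ∧
      0 < Matrix.det !![0, εj * rj + ηjk * rk, εk * rk + ηjk * rj;
                        εi * ri + ηik * rk, 0, εk * rk + ηik * ri;
                        εi * ri + ηij * rj, εj * rj + ηij * ri, 0] := by
  intro ri rj rk hi hj hk
  have det_eq_bound_add : Matrix.det !![0, εj * rj + ηjk * rk, εk * rk + ηjk * rj;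
                        εi * ri + ηik * rk, 0, εk * rk + ηik * ri;
                        εi * ri + ηij * rj, εj * rj + ηij * ri, 0] =
      2 * ri * rj * rk * (εi * εj + ηij) * (εi * εk + ηik) * (εj * εk + ηjk) +
        ((εi * ηjk + ηij * ηik) * ri * (εj * rj - εk * rk) ^ 2 +
          (εj * ηik + ηij * ηjk) * rj * (εi * ri - εk * rk) ^ 2 +
          (εk * ηij + ηik * ηjk) * rk * (εi * ri - εj * rj) ^ 2) := by
    rw [Matrix.det_fin_three]
    rcases hεi with rfl | rfl <;> rcases hεj with rfl | rfl <;> rcases hεk with rfl | rfl <;>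
      simp <;> ring
  have bound_pos :
      0 < 2 * ri * rj * rk * (εi * εj + ηij) * (εi * εk + ηik) * (εj * εk + ηjk) := by
    positivity
  have remainder_nonneg :
      0 ≤ (εi * ηjk + ηij * ηik) * ri * (εj * rj - εk * rk) ^ 2 +
          (εj * ηik + ηij * ηjk) * rj * (εi * ri - εk * rk) ^ 2 +
          (εk * ηij + ηik * ηjk) * rk * (εi * ri - εj * rj) ^ 2 := by
    positivity
  rw [det_eq_bound_add]
  constructor <;> linarith
end

section
/- Assume (S1) and (S2), and let (r_i, r_j, r_k) > 0 satisfy Q^E > 0, so that l_ij, l_ik, l_jk form a nondegenerate Euclidean triangle. Regard the inner angles θ_i, θ_j, θ_k (given by the Euclidean cosine law, θ_p = arccos of the corresponding cosine-law ratio of l_ij, l_ik, l_jk) as functions of (u_i, u_j, u_k) ∈ ℝ³ via r_q = e^{u_q}. Then the 3×3 Jacobian matrix (∂θ_p/∂u_q)_{p,q ∈ {i,j,k}} is symmetric and negative semidefinite, has rank 2, and its kernel is exactly the line ℝ·(1,1,1). -/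
/-- The Jacobian matrix `(∂θ_p/∂u_q)_{p,q ∈ {i,j,k}}` of the three inner angles with
respect to the logarithmic coordinates `(u_i, u_j, u_k)`. -/
noncomputable def JacE (εi εj εk ηij ηik ηjk ui uj uk : ℝ) : Matrix (Fin 3) (Fin 3) ℝ :=
  !![deriv (fun t => thetaEu εi εj εk ηij ηik ηjk t uj uk) ui,
     deriv (fun t => thetaEu εi εj εk ηij ηik ηjk ui t uk) uj,
     deriv (fun t => thetaEu εi εj εk ηij ηik ηjk ui uj t) uk;
     deriv (fun t => thetaEu εj εi εk ηij ηjk ηik uj t uk) ui,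
     deriv (fun t => thetaEu εj εi εk ηij ηjk ηik t ui uk) uj,
     deriv (fun t => thetaEu εj εi εk ηij ηjk ηik uj ui t) uk;
     deriv (fun t => thetaEu εk εi εj ηik ηjk ηij uk t uj) ui,
     deriv (fun t => thetaEu εk εi εj ηik ηjk ηij uk ui t) uj,
     deriv (fun t => thetaEu εk εi εj ηik ηjk ηij t ui uj) uk]

/-- The cosine-law angle differentiates through the squared side lengths. -/
theorem HasDerivAt.arccos_cosineLaw {f g h : ℝ → ℝ} {f' g' h' E t : ℝ}
    (hf : HasDerivAt f f' t) (hg : HasDerivAt g g' t) (hh : HasDerivAt h h' t)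
    (hf0 : 0 < f t) (hg0 : 0 < g t) (hh0 : 0 < h t) (hE : 0 < E)
    (hE2 : 4 * E ^ 2 = 4 * f t * g t - (f t + g t - h t) ^ 2) :
    HasDerivAt (fun s => Real.arccos ((√(f s) ^ 2 + √(g s) ^ 2 - √(h s) ^ 2) /
        (2 * √(f s) * √(g s))))
      (-(1 / (2 * E)) * (f' + g' - h' - (f t + g t - h t) * f' / (2 * f t) -
        (f t + g t - h t) * g' / (2 * g t))) t := by
  have hF := hf.sqrt hf0.ne'
  have hG := hg.sqrt hg0.ne'
  have hH := hh.sqrt hh0.ne'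
  have pF := Real.sqrt_pos.2 hf0
  have pG := Real.sqrt_pos.2 hg0
  have pH := Real.sqrt_pos.2 hh0
  have sF := Real.sq_sqrt hf0.le
  have sG := Real.sq_sqrt hg0.le
  have sH := Real.sq_sqrt hh0.le
  have hq := (((hF.fun_pow 2).fun_add (hG.fun_pow 2)).fun_sub (hH.fun_pow 2)).fun_div
    ((hF.const_mul 2).fun_mul hG) (by positivity)
  set F := √(f t)
  set G := √(g t)
  set H := √(h t)
  rw [← sF, ← sG, ← sH] at hE2
  rw [← sF, ← sG, ← sH]
  set c := (F ^ 2 + G ^ 2 - H ^ 2) / (2 * F * G) with hc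
  have hsin : 1 - c ^ 2 = (E / (F * G)) ^ 2 := by
    rw [hc]
    field_simp
    linear_combination -hE2
  have hsin0 : 0 < (E / (F * G)) ^ 2 := by positivity
  have hc1 : c ≠ -1 := by
    intro hcc
    rw [hcc] at hsin
    linarith
  have hc2 : c ≠ 1 := by
    intro hcc
    rw [hcc] at hsin
    linarith
  have hmain := (Real.hasDerivAt_arccos hc1 hc2).comp t hq
  refine hmain.congr_deriv ?_
  rw [hsin, Real.sqrt_sq (by positivity)]
  field_simp
  ring

theorem hasDerivAt_sq_length {εs εt η a' b' t : ℝ} {a b : ℝ → ℝ}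
    (ha : HasDerivAt a a' t) (hb : HasDerivAt b b' t) :
    HasDerivAt (fun s => εs * Real.exp (a s) ^ 2 + εt * Real.exp (b s) ^ 2 +
        2 * η * Real.exp (a s) * Real.exp (b s))
      (2 * εs * Real.exp (a t) ^ 2 * a' + 2 * εt * Real.exp (b t) ^ 2 * b' +
        2 * η * Real.exp (a t) * Real.exp (b t) * (a' + b')) t := by
  refine ((((ha.exp.fun_pow 2).const_mul εs).fun_add ((hb.exp.fun_pow 2).const_mul εt)).fun_add
    ((ha.exp.const_mul (2 * η)).fun_mul hb.exp)).congr_deriv ?_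
  simp only [Nat.cast_ofNat]
  ring

theorem deriv_thetaEu {ε1 ε2 ε3 η12 η13 η23 a' b' c' t A B C x y z E : ℝ} {a b c : ℝ → ℝ}
    (ha : HasDerivAt a a' t) (hb : HasDerivAt b b' t) (hc : HasDerivAt c c' t)
    (hA : Real.exp (a t) = A) (hB : Real.exp (b t) = B) (hC : Real.exp (c t) = C)
    (hx : x = ε1 * A ^ 2 + ε2 * B ^ 2 + 2 * η12 * A * B)
    (hy : y = ε1 * A ^ 2 + ε3 * C ^ 2 + 2 * η13 * A * C)
    (hz : z = ε2 * B ^ 2 + ε3 * C ^ 2 + 2 * η23 * B * C)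
    (hx0 : 0 < x) (hy0 : 0 < y) (hz0 : 0 < z) (hE : 0 < E)
    (hE2 : 4 * E ^ 2 = 4 * x * y - (x + y - z) ^ 2) :
    deriv (fun s => thetaEu ε1 ε2 ε3 η12 η13 η23 (a s) (b s) (c s)) t =
      -(1 / (2 * E)) *
        ((2 * ε1 * A ^ 2 * a' + 2 * ε2 * B ^ 2 * b' + 2 * η12 * A * B * (a' + b')) *
            (1 - (x + y - z) / (2 * x)) +
          (2 * ε1 * A ^ 2 * a' + 2 * ε3 * C ^ 2 * c' + 2 * η13 * A * C * (a' + c')) *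
            (1 - (x + y - z) / (2 * y)) -
          (2 * ε2 * B ^ 2 * b' + 2 * ε3 * C ^ 2 * c' + 2 * η23 * B * C * (b' + c'))) := by
  subst hA hB hC
  have key := HasDerivAt.arccos_cosineLaw (E := E)
    (hasDerivAt_sq_length (εs := ε1) (εt := ε2) (η := η12) ha hb)
    (hasDerivAt_sq_length (εs := ε1) (εt := ε3) (η := η13) ha hc)
    (hasDerivAt_sq_length (εs := ε2) (εt := ε3) (η := η23) hb hc)
    (by rwa [← hx]) (by rwa [← hy]) (by rwa [← hz]) hE (by rwa [← hx, ← hy, ← hz])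
  simp only [← hx, ← hy, ← hz] at key
  refine key.deriv.trans ?_
  ring

theorem deriv_thetaEu_fst {ε1 ε2 ε3 η12 η13 η23 a b c A B C x y z E M N : ℝ}
    (hA : Real.exp a = A) (hB : Real.exp b = B) (hC : Real.exp c = C)
    (hx : x = ε1 * A ^ 2 + ε2 * B ^ 2 + 2 * η12 * A * B)
    (hy : y = ε1 * A ^ 2 + ε3 * C ^ 2 + 2 * η13 * A * C)
    (hz : z = ε2 * B ^ 2 + ε3 * C ^ 2 + 2 * η23 * B * C)
    (hx0 : 0 < x) (hy0 : 0 < y) (hz0 : 0 < z) (hE : 0 < E)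
    (hE2 : 4 * E ^ 2 = 4 * x * y - (x + y - z) ^ 2)
    (hM : M = A * B * ((ε1 * ε2 - η12 ^ 2) * A * B + (ε2 * η13 + η12 * η23) * B * C +
      (ε1 * η23 + η12 * η13) * A * C))
    (hN : N = A * C * ((ε1 * ε3 - η13 ^ 2) * A * C + (ε3 * η12 + η13 * η23) * B * C +
      (ε1 * η23 + η12 * η13) * A * B)) :
    deriv (fun t => thetaEu ε1 ε2 ε3 η12 η13 η23 t b c) a = -(M / (x * E) + N / (y * E)) := by
  have h := deriv_thetaEu (hasDerivAt_id a) (hasDerivAt_const _ b) (hasDerivAt_const _ c)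
    hA hB hC hx hy hz hx0 hy0 hz0 hE hE2
  simp only [id] at h
  rw [h]
  field_simp
  rw [hM, hN, hx, hy, hz]
  ring

theorem deriv_thetaEu_snd {ε1 ε2 ε3 η12 η13 η23 a b c A B C x y z E M : ℝ}
    (hA : Real.exp a = A) (hB : Real.exp b = B) (hC : Real.exp c = C)
    (hx : x = ε1 * A ^ 2 + ε2 * B ^ 2 + 2 * η12 * A * B)
    (hy : y = ε1 * A ^ 2 + ε3 * C ^ 2 + 2 * η13 * A * C)
    (hz : z = ε2 * B ^ 2 + ε3 * C ^ 2 + 2 * η23 * B * C)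
    (hx0 : 0 < x) (hy0 : 0 < y) (hz0 : 0 < z) (hE : 0 < E)
    (hE2 : 4 * E ^ 2 = 4 * x * y - (x + y - z) ^ 2)
    (hM : M = A * B * ((ε1 * ε2 - η12 ^ 2) * A * B + (ε2 * η13 + η12 * η23) * B * C +
      (ε1 * η23 + η12 * η13) * A * C)) :
    deriv (fun t => thetaEu ε1 ε2 ε3 η12 η13 η23 a t c) b = M / (x * E) := by
  have h := deriv_thetaEu (hasDerivAt_const _ a) (hasDerivAt_id b) (hasDerivAt_const _ c)
    hA hB hC hx hy hz hx0 hy0 hz0 hE hE2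
  simp only [id] at h
  rw [h]
  field_simp
  rw [hM, hx, hy, hz]
  ring

theorem deriv_thetaEu_trd {ε1 ε2 ε3 η12 η13 η23 a b c A B C x y z E N : ℝ}
    (hA : Real.exp a = A) (hB : Real.exp b = B) (hC : Real.exp c = C)
    (hx : x = ε1 * A ^ 2 + ε2 * B ^ 2 + 2 * η12 * A * B)
    (hy : y = ε1 * A ^ 2 + ε3 * C ^ 2 + 2 * η13 * A * C)
    (hz : z = ε2 * B ^ 2 + ε3 * C ^ 2 + 2 * η23 * B * C)
    (hx0 : 0 < x) (hy0 : 0 < y) (hz0 : 0 < z) (hE : 0 < E)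
    (hE2 : 4 * E ^ 2 = 4 * x * y - (x + y - z) ^ 2)
    (hN : N = A * C * ((ε1 * ε3 - η13 ^ 2) * A * C + (ε3 * η12 + η13 * η23) * B * C +
      (ε1 * η23 + η12 * η13) * A * B)) :
    deriv (fun t => thetaEu ε1 ε2 ε3 η12 η13 η23 a b t) c = N / (y * E) := by
  have h := deriv_thetaEu (hasDerivAt_const _ a) (hasDerivAt_const _ b) (hasDerivAt_id c)
    hA hB hC hx hy hz hx0 hy0 hz0 hE hE2
  simp only [id] at h
  rw [h]
  field_simp
  rw [hN, hx, hy, hz]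
  ring

/-- A symmetric weighted graph Laplacian on three vertices is positive semidefinite of rank two
as soon as one vertex degree and the second elementary symmetric function of the weights are
positive. -/
theorem laplacian_three {a b c : ℝ} (hab : 0 < a + b) (he : 0 < a * b + a * c + b * c)
    {M : Matrix (Fin 3) (Fin 3) ℝ}
    (hM : M = !![-(a + b), a, b; a, -(a + c), c; b, c, -(b + c)]) :
    M.IsSymm ∧ (-M).PosSemidef ∧ M.rank = 2 ∧
      ∀ v : Fin 3 → ℝ, M.mulVec v = 0 ↔ ∃ t : ℝ, v = fun _ => t := by
  have hsymm : M.IsSymm := by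
    subst hM
    ext p q
    fin_cases p <;> fin_cases q <;> rfl
  have hker : ∀ v : Fin 3 → ℝ, M.mulVec v = 0 ↔ ∃ t : ℝ, v = fun _ => t := by
    intro v
    subst hM
    constructor
    · intro h
      have h0 := congrFun h 0
      have h1 := congrFun h 1
      simp [Matrix.mulVec, dotProduct, Fin.sum_univ_three] at h0 h1
      have h12 : v 1 = v 2 := by
        have : (a * b + a * c + b * c) * (v 1 - v 2) = 0 := by
          linear_combination -a * h0 - (a + b) * h1
        rcases mul_eq_zero.1 this with h | h
        · exact absurd h he.ne'
        · linarith
      have h02 : v 0 = v 2 := by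
        have : (a + b) * (v 0 - v 2) = 0 := by
          linear_combination -h0 + a * h12
        rcases mul_eq_zero.1 this with h | h
        · exact absurd h hab.ne'
        · linarith
      refine ⟨v 2, ?_⟩
      ext p
      fin_cases p
      · exact h02
      · exact h12
      · rfl
    · rintro ⟨t, rfl⟩
      ext p
      fin_cases p <;> simp [Matrix.mulVec, dotProduct, Fin.sum_univ_three] <;> ring
  refine ⟨hsymm, ?_, ?_, hker⟩
  · refine Matrix.PosSemidef.of_dotProduct_mulVec_nonneg ?_ ?_
    · rw [Matrix.IsHermitian, Matrix.conjTranspose_neg, Matrix.conjTranspose_eq_transpose_of_trivial,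
        hsymm.eq]
    · intro v
      have hform : star v ⬝ᵥ (-M).mulVec v =
          (((a + b) * v 0 - a * v 1 - b * v 2) ^ 2 +
            (a * b + a * c + b * c) * (v 1 - v 2) ^ 2) / (a + b) := by
        subst hM
        rw [eq_div_iff hab.ne']
        simp [Matrix.mulVec, dotProduct, Fin.sum_univ_three]
        ring
      rw [hform]
      positivity
  · have hspan : LinearMap.ker M.mulVecLin = Submodule.span ℝ {fun _ => (1 : ℝ)} := by
      ext v
      rw [LinearMap.mem_ker, Matrix.mulVecLin_apply, hker, Submodule.mem_span_singleton]
      refine exists_congr fun t => ?_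
      rw [eq_comm]
      simp [funext_iff]
    have hrank := LinearMap.finrank_range_add_finrank_ker M.mulVecLin
    rw [hspan, finrank_span_singleton (fun h => one_ne_zero (congrFun h (0 : Fin 3)))] at hrank
    simp at hrank
    exact hrank

theorem sq_length_pos {εs εt η A B : ℝ} (hs : εs = 0 ∨ εs = 1) (ht : εt = 0 ∨ εt = 1)
    (h : 0 < εs * εt + η) (hA : 0 < A) (hB : 0 < B) :
    0 < εs * A ^ 2 + εt * B ^ 2 + 2 * η * A * B := by
  have hAB := mul_pos h (mul_pos hA hB)
  rcases hs with rfl | rfl <;> rcases ht with rfl | rfl <;>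
    nlinarith [sq_nonneg (A - B), sq_nonneg A, sq_nonneg B]

/-- Up to a positive factor, this is the Jacobian determinant of the squared edge lengths with
respect to the radii. -/
theorem length_jacobian_pos {εi εj εk p q s A B C : ℝ}
    (hεi : εi = 0 ∨ εi = 1) (hεj : εj = 0 ∨ εj = 1) (hεk : εk = 0 ∨ εk = 1)
    (hp : 0 < εi * εj + p) (hq : 0 < εi * εk + q) (hs : 0 < εj * εk + s)
    (hi : 0 ≤ εi * s + p * q) (hj : 0 ≤ εj * q + p * s) (hk : 0 ≤ εk * p + q * s)
    (hA : 0 < A) (hB : 0 < B) (hC : 0 < C) :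
    0 < (εi * A + p * B) * (εk * C + q * A) * (εj * B + s * C) +
      (εj * B + p * A) * (εi * A + q * C) * (εk * C + s * B) := by
  have hexp : (εi * A + p * B) * (εk * C + q * A) * (εj * B + s * C) +
      (εj * B + p * A) * (εi * A + q * C) * (εk * C + s * B) =
      2 * (εi * εj * εk + p * q * s) * (A * B * C) +
        (εi * s + p * q) * A * (εj * B ^ 2 + εk * C ^ 2) +
        (εj * q + p * s) * B * (εi * A ^ 2 + εk * C ^ 2) +
        (εk * p + q * s) * C * (εi * A ^ 2 + εj * B ^ 2) := by
    ring
  have zero_case : ∀ {ε₂ ε₃ p q s A B C : ℝ}, (ε₂ = 0 ∨ ε₂ = 1) → (ε₃ = 0 ∨ ε₃ = 1) →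
      0 < p → 0 < q → 0 < ε₂ * ε₃ + s → 0 ≤ ε₂ * q + p * s → 0 ≤ ε₃ * p + q * s →
      0 < A → 0 < B → 0 < C →
      0 < 2 * (p * q * s) * (A * B * C) + p * q * A * (ε₂ * B ^ 2 + ε₃ * C ^ 2) +
        (ε₂ * q + p * s) * B * (ε₃ * C ^ 2) + (ε₃ * p + q * s) * C * (ε₂ * B ^ 2) := by
    intro ε₂ ε₃ p q s A B C h₂ h₃ hp hq hs hj hk hA hB hC
    have h1 : 0 < p * q * A * (ε₂ * B ^ 2 + ε₃ * C ^ 2 + 2 * s * B * C) :=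
      mul_pos (by positivity) (sq_length_pos h₂ h₃ hs hB hC)
    have h₂' : 0 ≤ ε₂ := by rcases h₂ with rfl | rfl <;> norm_num
    have h₃' : 0 ≤ ε₃ := by rcases h₃ with rfl | rfl <;> norm_num
    have h2 : 0 ≤ (ε₂ * q + p * s) * B * (ε₃ * C ^ 2) :=
      mul_nonneg (mul_nonneg hj hB.le) (by positivity)
    have h3 : 0 ≤ (ε₃ * p + q * s) * C * (ε₂ * B ^ 2) :=
      mul_nonneg (mul_nonneg hk hC.le) (by positivity)
    linarith
  rw [hexp]
  rcases hεi with rfl | rfl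
  · have := zero_case (p := p) (q := q) (s := s) hεj hεk (by linarith) (by linarith) hs hj hk
      hA hB hC
    linarith
  rcases hεj with rfl | rfl
  · have := zero_case (p := p) (q := s) (s := q) (Or.inr rfl) hεk (by linarith) (by linarith)
      hq (by linarith) (by linarith) hB hA hC
    linarith
  rcases hεk with rfl | rfl
  · have := zero_case (p := q) (q := s) (s := p) (Or.inr rfl) (Or.inr rfl) (by linarith)
      (by linarith) hp (by linarith) (by linarith) hC hA hB
    linarith
  · have h0 : 0 < (1 + p) * (1 + q) * (1 + s) * (A * B * C) := by
      have : 0 < 1 + p := by linarith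
      have : 0 < 1 + q := by linarith
      have : 0 < 1 + s := by linarith
      positivity
    have h1 := mul_nonneg (mul_nonneg hi hA.le) (sq_nonneg (B - C))
    have h2 := mul_nonneg (mul_nonneg hj hB.le) (sq_nonneg (A - C))
    have h3 := mul_nonneg (mul_nonneg hk hC.le) (sq_nonneg (A - B))
    linarith

theorem stmt11 (εi εj εk ηij ηik ηjk : ℝ)
    (hεi : εi = 0 ∨ εi = 1) (hεj : εj = 0 ∨ εj = 1) (hεk : εk = 0 ∨ εk = 1)
    (hS1ij : 0 < εi * εj + ηij) (hS1ik : 0 < εi * εk + ηik) (hS1jk : 0 < εj * εk + ηjk)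
    (hS2i : 0 ≤ εi * ηjk + ηij * ηik) (hS2j : 0 ≤ εj * ηik + ηij * ηjk)
    (hS2k : 0 ≤ εk * ηij + ηik * ηjk)
    (ui uj uk : ℝ)
    (hQ : 0 < QE εi εj εk ηij ηik ηjk (Real.exp ui) (Real.exp uj) (Real.exp uk)) :
    (JacE εi εj εk ηij ηik ηjk ui uj uk).IsSymm ∧
    (-(JacE εi εj εk ηij ηik ηjk ui uj uk)).PosSemidef ∧
    (JacE εi εj εk ηij ηik ηjk ui uj uk).rank = 2 ∧
    (∀ v : Fin 3 → ℝ,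
      (JacE εi εj εk ηij ηik ηjk ui uj uk).mulVec v = 0 ↔ ∃ t : ℝ, v = fun _ => t) := by
  have hA := Real.exp_pos ui
  have hB := Real.exp_pos uj
  have hC := Real.exp_pos uk
  have hx0 := sq_length_pos hεi hεj hS1ij hA hB
  have hy0 := sq_length_pos hεi hεk hS1ik hA hC
  have hz0 := sq_length_pos hεj hεk hS1jk hB hC
  have hdet := length_jacobian_pos hεi hεj hεk hS1ij hS1ik hS1jk hS2i hS2j hS2k hA hB hC
  obtain ⟨A, hAd⟩ : ∃ A, Real.exp ui = A := ⟨_, rfl⟩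
  obtain ⟨B, hBd⟩ : ∃ B, Real.exp uj = B := ⟨_, rfl⟩
  obtain ⟨C, hCd⟩ : ∃ C, Real.exp uk = C := ⟨_, rfl⟩
  rw [hAd, hBd, hCd] at hQ hdet
  rw [hAd] at hA hx0 hy0
  rw [hBd] at hB hx0 hz0
  rw [hCd] at hC hy0 hz0
  obtain ⟨x, hx⟩ : ∃ x, x = εi * A ^ 2 + εj * B ^ 2 + 2 * ηij * A * B := ⟨_, rfl⟩
  obtain ⟨y, hy⟩ : ∃ y, y = εi * A ^ 2 + εk * C ^ 2 + 2 * ηik * A * C := ⟨_, rfl⟩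
  obtain ⟨z, hz⟩ : ∃ z, z = εj * B ^ 2 + εk * C ^ 2 + 2 * ηjk * B * C := ⟨_, rfl⟩
  rw [← hx] at hx0
  rw [← hy] at hy0
  rw [← hz] at hz0
  obtain ⟨Nk, hNk⟩ : ∃ N, N = A * B * ((εi * εj - ηij ^ 2) * A * B +
    (εj * ηik + ηij * ηjk) * B * C + (εi * ηjk + ηij * ηik) * A * C) := ⟨_, rfl⟩
  obtain ⟨Nj, hNj⟩ : ∃ N, N = A * C * ((εi * εk - ηik ^ 2) * A * C +
    (εk * ηij + ηik * ηjk) * B * C + (εi * ηjk + ηij * ηik) * A * B) := ⟨_, rfl⟩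
  obtain ⟨Ni, hNi⟩ : ∃ N, N = B * C * ((εj * εk - ηjk ^ 2) * B * C +
    (εk * ηij + ηik * ηjk) * A * C + (εj * ηik + ηij * ηjk) * A * B) := ⟨_, rfl⟩
  have hQN : (A * B * C) ^ 2 * QE εi εj εk ηij ηik ηjk A B C = Ni + Nj + Nk := by
    rw [hNi, hNj, hNk, QE]
    field_simp
    ring
  have hN : 0 < Ni + Nj + Nk := by
    rw [← hQN]
    positivity
  have hD : 4 * (Ni + Nj + Nk) = 4 * x * y - (x + y - z) ^ 2 := by
    rw [hNi, hNj, hNk, hx, hy, hz]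
    ring
  have hE : 0 < √(Ni + Nj + Nk) := Real.sqrt_pos.2 hN
  have hE2 := Real.sq_sqrt hN.le
  have hquad : 0 < Nk * Nj * z + Nk * Ni * y + Ni * Nj * x := by
    have := mul_pos (mul_pos (mul_pos hA (mul_pos hB hC)) hN) hdet
    refine this.trans_eq ?_
    rw [hNi, hNj, hNk, hx, hy, hz]
    ring
  generalize √(Ni + Nj + Nk) = E at hE hE2
  rw [← hE2] at hD
  have he : 0 < Nk / (x * E) * (Nj / (y * E)) + Nk / (x * E) * (Ni / (z * E)) +
      Nj / (y * E) * (Ni / (z * E)) := by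
    have : Nk / (x * E) * (Nj / (y * E)) + Nk / (x * E) * (Ni / (z * E)) +
        Nj / (y * E) * (Ni / (z * E)) =
        (Nk * Nj * z + Nk * Ni * y + Ni * Nj * x) / (x * y * z * E ^ 2) := by
      field_simp
    rw [this]
    positivity
  have hab : 0 < Nk / (x * E) + Nj / (y * E) := by
    have h : (Nk / (x * E) + Nj / (y * E)) * ((Ni + Nj + Nk) / E) =
        x * (Nk / (x * E) + (x + y - z) / (2 * x) * (Nj / (y * E))) ^ 2 +
        E ^ 2 / x * (Nj / (y * E)) ^ 2 +
        z * (Nk / (x * E) * (Nj / (y * E)) + Nk / (x * E) * (Ni / (z * E)) +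
          Nj / (y * E) * (Ni / (z * E))) := by
      field_simp
      linear_combination -Nj ^ 2 * hD
    have hpos : 0 < (Nk / (x * E) + Nj / (y * E)) * ((Ni + Nj + Nk) / E) := by
      rw [h]
      positivity
    exact pos_of_mul_pos_left hpos (by positivity)
  refine laplacian_three hab he ?_
  rw [JacE]
  rw [deriv_thetaEu_fst hAd hBd hCd
    (hx.trans (by ring)) (hy.trans (by ring)) (hz.trans (by ring))
    hx0 hy0 hz0 hE (by linarith) (hNk.trans (by ring)) (hNj.trans (by ring))]
  rw [deriv_thetaEu_snd hAd hBd hCd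
    (hx.trans (by ring)) (hy.trans (by ring)) (hz.trans (by ring))
    hx0 hy0 hz0 hE (by linarith) (hNk.trans (by ring))]
  rw [deriv_thetaEu_trd hAd hBd hCd
    (hx.trans (by ring)) (hy.trans (by ring)) (hz.trans (by ring))
    hx0 hy0 hz0 hE (by linarith) (hNj.trans (by ring))]
  rw [deriv_thetaEu_snd hBd hAd hCd
    (hx.trans (by ring)) (hz.trans (by ring)) (hy.trans (by ring))
    hx0 hz0 hy0 hE (by linarith) (hNk.trans (by ring))]
  rw [deriv_thetaEu_fst hBd hAd hCd
    (hx.trans (by ring)) (hz.trans (by ring)) (hy.trans (by ring))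
    hx0 hz0 hy0 hE (by linarith) (hNk.trans (by ring)) (hNi.trans (by ring))]
  rw [deriv_thetaEu_trd hBd hAd hCd
    (hx.trans (by ring)) (hz.trans (by ring)) (hy.trans (by ring))
    hx0 hz0 hy0 hE (by linarith) (hNi.trans (by ring))]
  rw [deriv_thetaEu_snd hCd hAd hBd
    (hy.trans (by ring)) (hz.trans (by ring)) (hx.trans (by ring))
    hy0 hz0 hx0 hE (by linarith) (hNj.trans (by ring))]
  rw [deriv_thetaEu_trd hCd hAd hBd
    (hy.trans (by ring)) (hz.trans (by ring)) (hx.trans (by ring))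
    hy0 hz0 hx0 hE (by linarith) (hNi.trans (by ring))]
  rw [deriv_thetaEu_fst hCd hAd hBd
    (hy.trans (by ring)) (hz.trans (by ring)) (hx.trans (by ring))
    hy0 hz0 hx0 hE (by linarith) (hNj.trans (by ring)) (hNi.trans (by ring))]
end

section
/- Assume (S1) and (S2). If r_i, r_j, r_k > 0 satisfy Q^E = 0 and h_i < 0, then the Euclidean edge lengths satisfy l_jk = l_ij + l_ik; that is, on the boundary component of the degenerate region corresponding to the vertex i, the triangle degenerates with the angle at i equal to π. -/
/-- Under the structure condition (S1) the radicand of an edge length is positive. -/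
theorem lE_radicand_pos {εs εt η rs rt : ℝ} (hεs : εs = 0 ∨ εs = 1) (hεt : εt = 0 ∨ εt = 1)
    (h : 0 < εs * εt + η) (hrs : 0 < rs) (hrt : 0 < rt) :
    0 < εs * rs ^ 2 + εt * rt ^ 2 + 2 * η * rs * rt := by
  have hp : 0 < (εs * εt + η) * (rs * rt) := by positivity
  rcases hεs with rfl | rfl <;> rcases hεt with rfl | rfl <;>
    nlinarith [sq_nonneg (rs - rt), sq_nonneg rs, sq_nonneg rt]

/-- Additivity of square roots `√c = √a + √b` for a degenerate triangle with obtuse angle. -/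
theorem sqrt_eq_sqrt_add_sqrt {a b d : ℝ} (ha : 0 ≤ a) (hb : 0 ≤ b) (hd : d ≤ 0)
    (h : d ^ 2 = a * b) : √(a + b - 2 * d) = √a + √b := by
  have hab : √a * √b = -d := by
    rw [← Real.sqrt_mul ha, ← h, Real.sqrt_sq_eq_abs, abs_of_nonpos hd]
  have hsq : a + b - 2 * d = (√a + √b) ^ 2 := by
    linear_combination -Real.sq_sqrt ha - Real.sq_sqrt hb - 2 * hab
  rw [hsq, Real.sqrt_sq (by positivity)]

/-- If `p * x + g * y + u < 0` and `q * y + g * x + v < 0` with nonnegative `g`, `u`, `v` and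
positive `x`, `y`, then `g ^ 2 < p * q`. -/
theorem sq_lt_mul_of_add_neg {p q g u v x y : ℝ} (hx : 0 < x) (hy : 0 < y) (hg : 0 ≤ g)
    (hu : 0 ≤ u) (hv : 0 ≤ v) (h₁ : p * x + g * y + u < 0) (h₂ : q * y + g * x + v < 0) :
    g ^ 2 < p * q := by
  have h₁' : g * y < -p * x := by linarith
  have h₂' : g * x < -q * y := by linarith
  have h := mul_lt_mul'' h₁' h₂' (by positivity) (by positivity)
  have : 0 < (p * q - g ^ 2) * (x * y) := by linarith
  linarith [pos_of_mul_pos_left this (by positivity)]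

theorem stmt12 (εi εj εk ηij ηik ηjk : ℝ)
    (hεi : εi = 0 ∨ εi = 1) (hεj : εj = 0 ∨ εj = 1) (hεk : εk = 0 ∨ εk = 1)
    (hS1ij : 0 < εi * εj + ηij) (hS1ik : 0 < εi * εk + ηik) (hS1jk : 0 < εj * εk + ηjk)
    (hS2i : 0 ≤ εi * ηjk + ηij * ηik) (hS2j : 0 ≤ εj * ηik + ηij * ηjk)
    (hS2k : 0 ≤ εk * ηij + ηik * ηjk)
    (ri rj rk : ℝ) (hri : 0 < ri) (hrj : 0 < rj) (hrk : 0 < rk)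
    (hQ : QE εi εj εk ηij ηik ηjk ri rj rk = 0)
    (hhi : hVi εi εj εk ηij ηik ηjk ri rj rk < 0) :
    lE εj εk ηjk rj rk = lE εi εj ηij ri rj + lE εi εk ηik ri rk := by
  have hA := lE_radicand_pos hεi hεj hS1ij hri hrj
  have hB := lE_radicand_pos hεi hεk hS1ik hri hrk
  have hεj0 : 0 ≤ εj := by rcases hεj with rfl | rfl <;> norm_num
  have hεk0 : 0 ≤ εk := by rcases hεk with rfl | rfl <;> norm_num
  set D := εi * ri ^ 2 + ηij * ri * rj + ηik * ri * rk - ηjk * rj * rk with hD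
  have hDsq : D ^ 2 = (εi * ri ^ 2 + εj * rj ^ 2 + 2 * ηij * ri * rj) *
      (εi * ri ^ 2 + εk * rk ^ 2 + 2 * ηik * ri * rk) := by
    have : (εi * ri ^ 2 + εj * rj ^ 2 + 2 * ηij * ri * rj) *
        (εi * ri ^ 2 + εk * rk ^ 2 + 2 * ηik * ri * rk) - D ^ 2 =
        ri ^ 2 * rj ^ 2 * rk ^ 2 * QE εi εj εk ηij ηik ηjk ri rj rk := by
      rw [hD, QE]
      field_simp
      ring
    rw [hQ] at this
    linarith
  have hD0 : D ≤ 0 := by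
    have hDκ : D * (ri⁻¹ ^ 2 * rj⁻¹ * rk⁻¹) =
        εi * rj⁻¹ * rk⁻¹ + ηij * ri⁻¹ * rk⁻¹ + ηik * ri⁻¹ * rj⁻¹ - ηjk * ri⁻¹ ^ 2 := by
      rw [hD]
      field_simp
    have hx : 0 < ri⁻¹ := inv_pos.2 hri
    have hy : 0 < rj⁻¹ := inv_pos.2 hrj
    have hz : 0 < rk⁻¹ := inv_pos.2 hrk
    have hC := lE_radicand_pos hεk hεj (by linarith : 0 < εk * εj + ηjk) hy hz
    unfold QE at hQ
    unfold hVi at hhi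
    generalize ri⁻¹ = x at *
    generalize rj⁻¹ = y at *
    generalize rk⁻¹ = z at *
    set Δ := 2 * ηij * ηik * ηjk + εk * ηij ^ 2 + εi * ηjk ^ 2 + εj * ηik ^ 2 - εi * εj * εk
      with hΔ
    have hi_sq : ((εj * εk - ηjk ^ 2) * x + (εk * ηij + ηik * ηjk) * y +
        (εj * ηik + ηij * ηjk) * z) ^ 2 =
        Δ * (εk * y ^ 2 + εj * z ^ 2 + 2 * ηjk * y * z) := by
      linear_combination (εj * εk - ηjk ^ 2) * hQ
    have hΔpos : 0 < Δ :=
      pos_of_mul_pos_left (hi_sq ▸ sq_pos_of_neg hhi) hC.le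
    have hj : 0 ≤ (εi * εk - ηik ^ 2) * y + (εk * ηij + ηik * ηjk) * x +
        (εi * ηjk + ηij * ηik) * z := by
      by_contra! hneg
      have := sq_lt_mul_of_add_neg hx hy hS2k (by positivity) (by positivity) hhi hneg
      linarith [mul_nonneg hεk0 hΔpos.le]
    have hk : 0 ≤ (εi * εj - ηij ^ 2) * z + (εj * ηik + ηij * ηjk) * x +
        (εi * ηjk + ηij * ηik) * y := by
      by_contra! hneg
      have := sq_lt_mul_of_add_neg hx hz hS2j (p := εj * εk - ηjk ^ 2)
        (u := (εk * ηij + ηik * ηjk) * y)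
        (by positivity) (by positivity) (by linarith) hneg
      linarith [mul_nonneg hεj0 hΔpos.le]
    have hprod : Δ * -(D * (x ^ 2 * y * z)) =
        ((εi * εk - ηik ^ 2) * y + (εk * ηij + ηik * ηjk) * x + (εi * ηjk + ηij * ηik) * z) *
        ((εi * εj - ηij ^ 2) * z + (εj * ηik + ηij * ηjk) * x + (εi * ηjk + ηij * ηik) * y) := by
      rw [hDκ]
      linear_combination -(εi * ηjk + ηij * ηik) * hQ
    have hneg : 0 ≤ -(D * (x ^ 2 * y * z)) :=
      nonneg_of_mul_nonneg_right (hprod ▸ mul_nonneg hj hk) hΔpos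
    exact nonpos_of_mul_nonpos_left (neg_nonneg.1 hneg) (by positivity)
  have hsum := sqrt_eq_sqrt_add_sqrt hA.le hB.le hD0 hDsq
  unfold lE
  rw [← hsum, hD]
  congr 1
  ring
end

section
/- Assume (S1). Then for all f_i, f_j, f_k ∈ ℝ one has C_sC_t + η_st S_sS_t > 1 for every pair {s,t} ⊆ {i,j,k} (so the hyperbolic edge lengths l_st are well-defined positive reals), the identity 1 + 2·cosh l_ij·cosh l_ik·cosh l_jk − cosh² l_ij − cosh² l_ik − cosh² l_jk = S_i² S_j² S_k² Q^H holds, and consequently l_ij, l_ik, l_jk satisfy the three strict triangle inequalities if and only if Q^H > 0. -/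
/-- `C_q = √(1 + ε_q e^{2f_q})`. -/
noncomputable def CH (ε f : ℝ) : ℝ := Real.sqrt (1 + ε * Real.exp f ^ 2)

/-- `κ_q = C_q / S_q`. -/
noncomputable def kH (ε f : ℝ) : ℝ := CH ε f / Real.exp f

/-- Inverse hyperbolic cosine. -/
noncomputable def arcosh (x : ℝ) : ℝ := Real.log (x + Real.sqrt (x ^ 2 - 1))

/-- Hyperbolic edge length `l_st = arcosh(C_s C_t + η_st S_s S_t)`. -/
noncomputable def lH (εs εt ηst fs ft : ℝ) : ℝ :=
  arcosh (CH εs fs * CH εt ft + ηst * Real.exp fs * Real.exp ft)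

/-- The quantity `Q^H` (with `κ_q = C_q/S_q`, including the symmetric term `G`). -/
noncomputable def QH (εi εj εk ηij ηik ηjk fi fj fk : ℝ) : ℝ :=
  (εj * εk - ηjk ^ 2) * kH εi fi ^ 2 + (εi * εk - ηik ^ 2) * kH εj fj ^ 2 +
    (εi * εj - ηij ^ 2) * kH εk fk ^ 2 +
    2 * (εk * ηij + ηik * ηjk) * kH εi fi * kH εj fj +
    2 * (εj * ηik + ηij * ηjk) * kH εi fi * kH εk fk +
    2 * (εi * ηjk + ηij * ηik) * kH εj fj * kH εk fk +
    (εi * ηjk ^ 2 + εj * ηik ^ 2 + εk * ηij ^ 2 + 2 * ηij * ηik * ηjk - εi * εj * εk)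

/-- The hyperbolic cosine inverts `arcosh` on `[1, ∞)`. -/
theorem cosh_arcosh {x : ℝ} (hx : 1 ≤ x) : Real.cosh (arcosh x) = x :=
  Real.cosh_arcosh hx

theorem arcosh_pos {x : ℝ} (hx : 1 < x) : 0 < arcosh x :=
  Real.arcosh_pos hx

theorem one_add_mul_exp_sq_pos {ε : ℝ} (hε : ε = 0 ∨ ε = 1) (f : ℝ) :
    0 < 1 + ε * Real.exp f ^ 2 := by
  rcases hε with rfl | rfl <;> positivity

theorem CH_sq {ε : ℝ} (hε : ε = 0 ∨ ε = 1) (f : ℝ) :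
    CH ε f ^ 2 = 1 + ε * Real.exp f ^ 2 :=
  Real.sq_sqrt (one_add_mul_exp_sq_pos hε f).le

theorem one_add_mul_exp_le_CH_mul_CH {εs εt : ℝ} (hs : εs = 0 ∨ εs = 1)
    (ht : εt = 0 ∨ εt = 1) (fs ft : ℝ) :
    1 + εs * εt * (Real.exp fs * Real.exp ft) ≤ CH εs fs * CH εt ft := by
  rw [CH, CH, ← Real.sqrt_mul (one_add_mul_exp_sq_pos hs fs).le]
  apply Real.le_sqrt_of_sq_le
  rcases hs with rfl | rfl <;> rcases ht with rfl | rfl <;>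
    nlinarith [sq_nonneg (Real.exp fs), sq_nonneg (Real.exp ft),
      sq_nonneg (Real.exp fs - Real.exp ft)]

theorem one_lt_CH_mul_CH_add {εs εt η : ℝ} (hs : εs = 0 ∨ εs = 1)
    (ht : εt = 0 ∨ εt = 1) (h : 0 < εs * εt + η) (fs ft : ℝ) :
    1 < CH εs fs * CH εt ft + η * Real.exp fs * Real.exp ft := by
  nlinarith [one_add_mul_exp_le_CH_mul_CH hs ht fs ft,
    mul_pos h (mul_pos (Real.exp_pos fs) (Real.exp_pos ft))]

/-- Multiplying `QH` by the squares of the three `S_q` clears its denominators. -/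
theorem exp_sq_mul_QH (εi εj εk ηij ηik ηjk fi fj fk : ℝ) :
    Real.exp fi ^ 2 * Real.exp fj ^ 2 * Real.exp fk ^ 2 *
        QH εi εj εk ηij ηik ηjk fi fj fk =
      (εj * εk - ηjk ^ 2) * CH εi fi ^ 2 * (Real.exp fj * Real.exp fk) ^ 2 +
      (εi * εk - ηik ^ 2) * CH εj fj ^ 2 * (Real.exp fi * Real.exp fk) ^ 2 +
      (εi * εj - ηij ^ 2) * CH εk fk ^ 2 * (Real.exp fi * Real.exp fj) ^ 2 +
      2 * (εk * ηij + ηik * ηjk) * CH εi fi * CH εj fj *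
        (Real.exp fi * Real.exp fj * Real.exp fk ^ 2) +
      2 * (εj * ηik + ηij * ηjk) * CH εi fi * CH εk fk *
        (Real.exp fi * Real.exp fk * Real.exp fj ^ 2) +
      2 * (εi * ηjk + ηij * ηik) * CH εj fj * CH εk fk *
        (Real.exp fj * Real.exp fk * Real.exp fi ^ 2) +
      (εi * ηjk ^ 2 + εj * ηik ^ 2 + εk * ηij ^ 2 + 2 * ηij * ηik * ηjk - εi * εj * εk) *
        (Real.exp fi * Real.exp fj * Real.exp fk) ^ 2 := by
  have hi := Real.exp_ne_zero fi
  have hj := Real.exp_ne_zero fj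
  have hk := Real.exp_ne_zero fk
  simp only [QH, kH]
  field_simp

/-- The Gram determinant of three vectors whose pairwise products are
`C_s C_t + η_st S_s S_t` and whose self-products are `C_q ^ 2 - ε_q S_q ^ 2 = 1`. -/
theorem one_add_two_mul_sub_sq_eq_mul_QH {εi εj εk : ℝ} (ηij ηik ηjk : ℝ)
    (hεi : εi = 0 ∨ εi = 1) (hεj : εj = 0 ∨ εj = 1) (hεk : εk = 0 ∨ εk = 1)
    (fi fj fk : ℝ) :
    1 + 2 * (CH εi fi * CH εj fj + ηij * Real.exp fi * Real.exp fj) *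
          (CH εi fi * CH εk fk + ηik * Real.exp fi * Real.exp fk) *
          (CH εj fj * CH εk fk + ηjk * Real.exp fj * Real.exp fk) -
        (CH εi fi * CH εj fj + ηij * Real.exp fi * Real.exp fj) ^ 2 -
        (CH εi fi * CH εk fk + ηik * Real.exp fi * Real.exp fk) ^ 2 -
        (CH εj fj * CH εk fk + ηjk * Real.exp fj * Real.exp fk) ^ 2 =
      Real.exp fi ^ 2 * Real.exp fj ^ 2 * Real.exp fk ^ 2 *
        QH εi εj εk ηij ηik ηjk fi fj fk := by
  rw [exp_sq_mul_QH]
  have hi : CH εi fi ^ 2 - εi * Real.exp fi ^ 2 = 1 := by linarith [CH_sq hεi fi]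
  have hj : CH εj fj ^ 2 - εj * Real.exp fj ^ 2 = 1 := by linarith [CH_sq hεj fj]
  have hk : CH εk fk ^ 2 - εk * Real.exp fk ^ 2 = 1 := by linarith [CH_sq hεk fk]
  have gram : ∀ a b c x y z : ℝ, a = 1 → b = 1 → c = 1 →
      1 + 2 * x * y * z - x ^ 2 - y ^ 2 - z ^ 2 =
        a * b * c + 2 * x * y * z - c * x ^ 2 - b * y ^ 2 - a * z ^ 2 := by
    rintro a b c x y z rfl rfl rfl
    ring
  rw [gram _ _ _ _ _ _ hi hj hk]
  ring

/-- Three positive reals satisfy the strict triangle inequalities exactly when the Gram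
determinant of their hyperbolic cosines is positive. -/
theorem triangle_lt_iff_cosh {a b c : ℝ} (ha : 0 < a) (hb : 0 < b) (hc : 0 < c) :
    (a < b + c ∧ b < a + c ∧ c < a + b) ↔
      0 < 1 + 2 * Real.cosh a * Real.cosh b * Real.cosh c -
        Real.cosh a ^ 2 - Real.cosh b ^ 2 - Real.cosh c ^ 2 := by
  have factor : 1 + 2 * Real.cosh a * Real.cosh b * Real.cosh c -
        Real.cosh a ^ 2 - Real.cosh b ^ 2 - Real.cosh c ^ 2 =
      (Real.cosh (a + b) - Real.cosh c) * (Real.cosh c - Real.cosh (a - b)) := by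
    rw [Real.cosh_add, Real.cosh_sub]
    linear_combination Real.sinh b ^ 2 * Real.cosh_sq a +
      (Real.cosh a ^ 2 - 1) * Real.cosh_sq b
  have hlt : Real.cosh (a - b) < Real.cosh (a + b) := by
    rw [Real.cosh_lt_cosh, abs_of_pos (add_pos ha hb), abs_lt]
    constructor <;> linarith
  have hc_lt : Real.cosh c < Real.cosh (a + b) ↔ c < a + b := by
    rw [Real.cosh_lt_cosh, abs_of_pos hc, abs_of_pos (add_pos ha hb)]
  have lt_hc : Real.cosh (a - b) < Real.cosh c ↔ b < a + c ∧ a < b + c := by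
    rw [Real.cosh_lt_cosh, abs_of_pos hc, abs_lt]
    constructor <;> rintro ⟨h₁, h₂⟩ <;> constructor <;> linarith
  rw [factor]
  constructor
  · rintro ⟨h₁, h₂, h₃⟩
    exact mul_pos (sub_pos.2 (hc_lt.2 h₃)) (sub_pos.2 (lt_hc.2 ⟨h₂, h₁⟩))
  · intro h
    rcases mul_pos_iff.1 h with ⟨h₁, h₂⟩ | ⟨h₁, h₂⟩
    · obtain ⟨h₃, h₄⟩ := lt_hc.1 (sub_pos.1 h₂)
      exact ⟨h₄, h₃, hc_lt.1 (sub_pos.1 h₁)⟩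
    · linarith

theorem stmt13 (εi εj εk ηij ηik ηjk : ℝ)
    (hεi : εi = 0 ∨ εi = 1) (hεj : εj = 0 ∨ εj = 1) (hεk : εk = 0 ∨ εk = 1)
    (hS1ij : 0 < εi * εj + ηij) (hS1ik : 0 < εi * εk + ηik) (hS1jk : 0 < εj * εk + ηjk) :
    ∀ fi fj fk : ℝ,
      (1 < CH εi fi * CH εj fj + ηij * Real.exp fi * Real.exp fj) ∧
      (1 < CH εi fi * CH εk fk + ηik * Real.exp fi * Real.exp fk) ∧
      (1 < CH εj fj * CH εk fk + ηjk * Real.exp fj * Real.exp fk) ∧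
      (1 + 2 * Real.cosh (lH εi εj ηij fi fj) * Real.cosh (lH εi εk ηik fi fk) *
            Real.cosh (lH εj εk ηjk fj fk) -
          Real.cosh (lH εi εj ηij fi fj) ^ 2 - Real.cosh (lH εi εk ηik fi fk) ^ 2 -
          Real.cosh (lH εj εk ηjk fj fk) ^ 2 =
        Real.exp fi ^ 2 * Real.exp fj ^ 2 * Real.exp fk ^ 2 *
          QH εi εj εk ηij ηik ηjk fi fj fk) ∧
      ((lH εi εj ηij fi fj < lH εi εk ηik fi fk + lH εj εk ηjk fj fk ∧
          lH εi εk ηik fi fk < lH εi εj ηij fi fj + lH εj εk ηjk fj fk ∧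
          lH εj εk ηjk fj fk < lH εi εj ηij fi fj + lH εi εk ηik fi fk) ↔
        0 < QH εi εj εk ηij ηik ηjk fi fj fk) := by
  intro fi fj fk
  have hij := one_lt_CH_mul_CH_add hεi hεj hS1ij fi fj
  have hik := one_lt_CH_mul_CH_add hεi hεk hS1ik fi fk
  have hjk := one_lt_CH_mul_CH_add hεj hεk hS1jk fj fk
  have identity : 1 + 2 * Real.cosh (lH εi εj ηij fi fj) * Real.cosh (lH εi εk ηik fi fk) *
            Real.cosh (lH εj εk ηjk fj fk) -
          Real.cosh (lH εi εj ηij fi fj) ^ 2 - Real.cosh (lH εi εk ηik fi fk) ^ 2 -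
          Real.cosh (lH εj εk ηjk fj fk) ^ 2 =
        Real.exp fi ^ 2 * Real.exp fj ^ 2 * Real.exp fk ^ 2 *
          QH εi εj εk ηij ηik ηjk fi fj fk := by
    simp only [lH]
    rw [cosh_arcosh hij.le, cosh_arcosh hik.le, cosh_arcosh hjk.le]
    exact one_add_two_mul_sub_sq_eq_mul_QH ηij ηik ηjk hεi hεj hεk fi fj fk
  refine ⟨hij, hik, hjk, identity, ?_⟩
  have hS : 0 < Real.exp fi ^ 2 * Real.exp fj ^ 2 * Real.exp fk ^ 2 := by positivity
  exact (triangle_lt_iff_cosh (arcosh_pos hij) (arcosh_pos hik) (arcosh_pos hjk)).trans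
    (by rw [← lH, ← lH, ← lH, identity, mul_pos_iff_of_pos_left hS])
end

section
/- Assume (S1) and (S2), and additionally that ε_jε_k − η_jk² ≥ 0, ε_iε_k − η_ik² ≥ 0 and ε_iε_j − η_ij² ≥ 0. Then Q^H > 0 for every (f_i, f_j, f_k) ∈ ℝ³; that is, every triple (f_i, f_j, f_k) is a nondegenerate hyperbolic discrete conformal structure for the triangle. -/
theorem one_le_kH (f : ℝ) : 1 ≤ kH 1 f := by
  unfold kH CH
  rw [one_le_div (Real.exp_pos f)]
  exact Real.le_sqrt_of_sq_le (by linarith)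

/-- At `κ = (1, 1, 1)` with all weights `1`, `Q^H` equals `2 (1 + a) (1 + b) (1 + c)`, and it is
monotone in each `κ`. -/
theorem QH_one_pos {c b a : ℝ} (hc : 0 < 1 + c) (hb : 0 < 1 + b) (ha : 0 < 1 + a)
    (hi : 0 ≤ a + c * b) (hj : 0 ≤ b + c * a) (hk : 0 ≤ c + b * a)
    (hAi : 0 ≤ 1 - a ^ 2) (hAj : 0 ≤ 1 - b ^ 2) (hAk : 0 ≤ 1 - c ^ 2) (fi fj fk : ℝ) :
    0 < QH 1 1 1 c b a fi fj fk := by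
  unfold QH
  have hx := one_le_kH fi
  have hy := one_le_kH fj
  have hz := one_le_kH fk
  generalize kH 1 fi = x at *
  generalize kH 1 fj = y at *
  generalize kH 1 fk = z at *
  have hxx := mul_nonneg hAi (sub_nonneg.2 (one_le_pow₀ hx (n := 2)))
  have hyy := mul_nonneg hAj (sub_nonneg.2 (one_le_pow₀ hy (n := 2)))
  have hzz := mul_nonneg hAk (sub_nonneg.2 (one_le_pow₀ hz (n := 2)))
  have hxy := mul_nonneg hk (sub_nonneg.2 (one_le_mul_of_one_le_of_one_le hx hy))
  have hxz := mul_nonneg hj (sub_nonneg.2 (one_le_mul_of_one_le_of_one_le hx hz))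
  have hyz := mul_nonneg hi (sub_nonneg.2 (one_le_mul_of_one_le_of_one_le hy hz))
  have hpos : 0 < (1 + a) * (1 + b) * (1 + c) := by positivity
  linarith

/-- A weight of an edge satisfying both sign conditions forces both vertex weights to be `1`. -/
theorem eq_one_of_weight {ε δ η : ℝ} (hε : ε = 0 ∨ ε = 1) (hδ : δ = 0 ∨ δ = 1)
    (h : 0 < ε * δ + η) (hA : 0 ≤ ε * δ - η ^ 2) : ε = 1 ∧ δ = 1 := by
  rcases hε with rfl | rfl <;> rcases hδ with rfl | rfl <;>
    first
      | exact ⟨rfl, rfl⟩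
      | (exfalso; nlinarith)

theorem stmt14 (εi εj εk ηij ηik ηjk : ℝ)
    (hεi : εi = 0 ∨ εi = 1) (hεj : εj = 0 ∨ εj = 1) (hεk : εk = 0 ∨ εk = 1)
    (hS1ij : 0 < εi * εj + ηij) (hS1ik : 0 < εi * εk + ηik) (hS1jk : 0 < εj * εk + ηjk)
    (hS2i : 0 ≤ εi * ηjk + ηij * ηik) (hS2j : 0 ≤ εj * ηik + ηij * ηjk)
    (hS2k : 0 ≤ εk * ηij + ηik * ηjk)
    (hAi : 0 ≤ εj * εk - ηjk ^ 2) (hAj : 0 ≤ εi * εk - ηik ^ 2)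
    (hAk : 0 ≤ εi * εj - ηij ^ 2) :
    ∀ fi fj fk : ℝ, 0 < QH εi εj εk ηij ηik ηjk fi fj fk := by
  intro fi fj fk
  obtain ⟨rfl, rfl⟩ := eq_one_of_weight hεi hεj hS1ij hAk
  obtain ⟨-, rfl⟩ := eq_one_of_weight hεi hεk hS1ik hAj
  simp only [one_mul] at *
  exact QH_one_pos hS1ij hS1ik hS1jk hS2i hS2j hS2k hAi hAj hAk fi fj fk
end

section
/- Assume (S1) and (S2). If (f_i, f_j, f_k) ∈ ℝ³ satisfies Q^H ≤ 0 (i.e. the hyperbolic discrete conformal structure is degenerate), then exactly one of h_i, h_j, h_k is negative and the other two are positive, where the h's are formed with the hyperbolic quantities κ_q = C_q/S_q. -/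
/-- `h_i = (ε_jε_k − η_jk²)κ_i + γ_k κ_j + γ_j κ_k` with `κ_q = C_q/S_q`. -/
noncomputable def hHi (εi εj εk ηij ηik ηjk fi fj fk : ℝ) : ℝ :=
  (εj * εk - ηjk ^ 2) * kH εi fi + (εk * ηij + ηik * ηjk) * kH εj fj +
    (εj * ηik + ηij * ηjk) * kH εk fk

noncomputable def hHj (εi εj εk ηij ηik ηjk fi fj fk : ℝ) : ℝ :=
  (εi * εk - ηik ^ 2) * kH εj fj + (εk * ηij + ηik * ηjk) * kH εi fi +
    (εi * ηjk + ηij * ηik) * kH εk fk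

noncomputable def hHk (εi εj εk ηij ηik ηjk fi fj fk : ℝ) : ℝ :=
  (εi * εj - ηij ^ 2) * kH εk fk + (εj * ηik + ηij * ηjk) * kH εi fi +
    (εi * ηjk + ηij * ηik) * kH εj fj

theorem kH_pos {ε : ℝ} (hε : 0 ≤ ε) (f : ℝ) : 0 < kH ε f := by
  unfold kH CH
  positivity

theorem lt_kH_sq {ε : ℝ} (hε : 0 ≤ ε) (f : ℝ) : ε < kH ε f ^ 2 := by
  have hS : 0 < Real.exp f ^ 2 := by positivity
  unfold kH CH
  rw [div_pow, Real.sq_sqrt (by positivity), lt_div_iff₀ hS]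
  linarith

/-- The squared hyperbolic sine of an edge length, up to normalization, is positive. -/
theorem edge_form_pos {b c r y z : ℝ} (hb : b = 0 ∨ b = 1) (hc : c = 0 ∨ c = 1)
    (hr : 0 < b * c + r) (hy : 0 < y) (hz : 0 < z) (hyb : b < y ^ 2) (hzc : c < z ^ 2) :
    0 < c * y ^ 2 + b * z ^ 2 + 2 * r * y * z + r ^ 2 - b * c := by
  rcases hb with rfl | rfl <;> rcases hc with rfl | rfl
  · have hr' : 0 < r := by linarith
    have : 0 < 2 * r * y * z := by positivity
    nlinarith
  · have hr' : 0 < r := by linarith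
    have : 0 < 2 * r * y * z := by positivity
    nlinarith
  · have hr' : 0 < r := by linarith
    have : 0 < 2 * r * y * z := by positivity
    nlinarith
  · have hyz : 1 < y * z := by
      have h1 : 1 < y := by nlinarith
      have h2 : 1 < z := by nlinarith
      nlinarith
    have hlt : y * z - 1 < r + y * z := by linarith
    have hsq : (y * z - 1) ^ 2 < (r + y * z) ^ 2 := by
      apply pow_lt_pow_left₀ hlt (by linarith) (by norm_num)
    nlinarith [sq_nonneg (y - z)]

/-- If a diagonal cofactor is positive and the quadratic form is nonpositive, then `G > 0`. -/
theorem G_pos_of_cofactor_pos {a b c p q r x y z : ℝ} (hb : b = 0 ∨ b = 1)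
    (hc : c = 0 ∨ c = 1) (hr : 0 < b * c + r) (hj : 0 ≤ b * q + p * r)
    (hk : 0 ≤ c * p + q * r) (hx : 0 < x) (hy : 0 < y) (hz : 0 < z)
    (hyb : b < y ^ 2) (hzc : c < z ^ 2) (hM : 0 < b * c - r ^ 2)
    (hQ : (b * c - r ^ 2) * x ^ 2 + (a * c - q ^ 2) * y ^ 2 + (a * b - p ^ 2) * z ^ 2 +
      2 * (c * p + q * r) * x * y + 2 * (b * q + p * r) * x * z +
      2 * (a * r + p * q) * y * z +
      (a * r ^ 2 + b * q ^ 2 + c * p ^ 2 + 2 * p * q * r - a * b * c) ≤ 0) :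
    0 < a * r ^ 2 + b * q ^ 2 + c * p ^ 2 + 2 * p * q * r - a * b * c := by
  have hP := edge_form_pos hb hc hr hy hz hyb hzc
  have hh : 0 < (b * c - r ^ 2) * x + (c * p + q * r) * y + (b * q + p * r) * z := by
    positivity
  have hMQ := mul_nonpos_of_nonneg_of_nonpos hM.le hQ
  have hsq := pow_pos hh 2
  refine pos_of_mul_pos_left (b := c * y ^ 2 + b * z ^ 2 + 2 * r * y * z + r ^ 2 - b * c)
    ?_ hP.le
  linarith

theorem G_pos_of_cofactors_nonpos {a b c p q r : ℝ} (ha : a = 0 ∨ a = 1)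
    (hb : b = 0 ∨ b = 1) (hc : c = 0 ∨ c = 1) (hp : 0 < a * b + p) (hq : 0 < a * c + q)
    (hr : 0 < b * c + r) (hMi : b * c - r ^ 2 ≤ 0) (hMj : a * c - q ^ 2 ≤ 0)
    (hMk : a * b - p ^ 2 ≤ 0) :
    0 < a * r ^ 2 + b * q ^ 2 + c * p ^ 2 + 2 * p * q * r - a * b * c := by
  have key : ∀ {t s : ℝ}, t = 0 ∨ t = 1 → 0 < t + s → t - s ^ 2 ≤ 0 → 0 < s ∧ t ≤ s := by
    rintro t s (rfl | rfl) h1 h2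
    · constructor <;> linarith
    · constructor <;> nlinarith
  have prod : ∀ {s t : ℝ}, s = 0 ∨ s = 1 → t = 0 ∨ t = 1 → s * t = 0 ∨ s * t = 1 := by
    rintro s t (rfl | rfl) (rfl | rfl) <;> simp
  obtain ⟨hp0, hp1⟩ := key (prod ha hb) hp hMk
  obtain ⟨hq0, hq1⟩ := key (prod ha hc) hq hMj
  obtain ⟨hr0, hr1⟩ := key (prod hb hc) hr hMi
  have hpqr : 0 < p * q * r := by positivity
  have ha0 : 0 ≤ a := by rcases ha with rfl | rfl <;> norm_num
  have hb0 : 0 ≤ b := by rcases hb with rfl | rfl <;> norm_num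
  have hc0 : 0 ≤ c := by rcases hc with rfl | rfl <;> norm_num
  have h1 : a * (b * c) ≤ a * r ^ 2 := mul_le_mul_of_nonneg_left (by linarith) ha0
  have h2 : 0 ≤ b * q ^ 2 := by positivity
  have h3 : 0 ≤ c * p ^ 2 := by positivity
  linarith

/-- Two of the `h`'s cannot be simultaneously nonpositive with one of them negative. -/
theorem second_pos_of_first_neg {a b c p q r x y z : ℝ} (hc : 0 ≤ c)
    (hi : 0 ≤ a * r + p * q) (hj : 0 ≤ b * q + p * r) (hk : 0 ≤ c * p + q * r)
    (hx : 0 < x) (hy : 0 < y) (hz : 0 < z)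
    (hG : 0 < a * r ^ 2 + b * q ^ 2 + c * p ^ 2 + 2 * p * q * r - a * b * c)
    (h : (b * c - r ^ 2) * x + (c * p + q * r) * y + (b * q + p * r) * z < 0) :
    0 < (a * c - q ^ 2) * y + (c * p + q * r) * x + (a * r + p * q) * z := by
  by_contra! h'
  have hminor : (b * c - r ^ 2) * (a * c - q ^ 2) - (c * p + q * r) ^ 2 =
      -c * (a * r ^ 2 + b * q ^ 2 + c * p ^ 2 + 2 * p * q * r - a * b * c) := by ring
  have hdet : (a * c - q ^ 2) * b - (c * p + q * r) * p - (a * r + p * q) * r =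
      -(a * r ^ 2 + b * q ^ 2 + c * p ^ 2 + 2 * p * q * r - a * b * c) := by ring
  generalize a * r ^ 2 + b * q ^ 2 + c * p ^ 2 + 2 * p * q * r - a * b * c = G at *
  generalize b * c - r ^ 2 = A at *
  generalize a * c - q ^ 2 = B at *
  generalize c * p + q * r = K at *
  generalize b * q + p * r = J at *
  generalize a * r + p * q = I at *
  have hle : A * B ≤ K ^ 2 := by nlinarith [mul_nonneg hc hG.le]
  have hJz := mul_nonneg hj hz.le
  have hIz := mul_nonneg hi hz.le
  have hKx := mul_nonneg hk hx.le
  have hKy := mul_nonneg hk hy.le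
  have hA : K * y < -A * x := by linarith
  have hB : K * x ≤ -B * y := by linarith
  have hA0 : 0 < -A := pos_of_mul_pos_left (hKy.trans_lt hA) hx.le
  rcases hk.eq_or_lt with hK | hK
  · subst hK
    have hB0 : B = 0 := by
      have h1 : 0 ≤ -B := nonneg_of_mul_nonneg_left (by linarith) hy
      nlinarith
    subst hB0
    have hI : I = 0 := by
      have : I * z = 0 := by linarith
      exact (mul_eq_zero.mp this).resolve_right hz.ne'
    subst hI
    linarith
  · have hKx' := mul_pos hK hx
    have h1 : (K * y) * (K * x) < (-A * x) * (-B * y) := by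
      apply mul_lt_mul hA hB hKx'
      exact (hKy.trans_lt hA).le
    have h2 : 0 < (A * B - K ^ 2) * (x * y) := by linarith
    have h3 := pos_of_mul_pos_left h2 (mul_pos hx hy).le
    linarith

theorem stmt15 (εi εj εk ηij ηik ηjk : ℝ)
    (hεi : εi = 0 ∨ εi = 1) (hεj : εj = 0 ∨ εj = 1) (hεk : εk = 0 ∨ εk = 1)
    (hS1ij : 0 < εi * εj + ηij) (hS1ik : 0 < εi * εk + ηik) (hS1jk : 0 < εj * εk + ηjk)
    (hS2i : 0 ≤ εi * ηjk + ηij * ηik) (hS2j : 0 ≤ εj * ηik + ηij * ηjk)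
    (hS2k : 0 ≤ εk * ηij + ηik * ηjk)
    (fi fj fk : ℝ)
    (hQ : QH εi εj εk ηij ηik ηjk fi fj fk ≤ 0) :
    (hHi εi εj εk ηij ηik ηjk fi fj fk < 0 ∧ 0 < hHj εi εj εk ηij ηik ηjk fi fj fk ∧
        0 < hHk εi εj εk ηij ηik ηjk fi fj fk) ∨
    (hHj εi εj εk ηij ηik ηjk fi fj fk < 0 ∧ 0 < hHi εi εj εk ηij ηik ηjk fi fj fk ∧
        0 < hHk εi εj εk ηij ηik ηjk fi fj fk) ∨
    (hHk εi εj εk ηij ηik ηjk fi fj fk < 0 ∧ 0 < hHi εi εj εk ηij ηik ηjk fi fj fk ∧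
        0 < hHj εi εj εk ηij ηik ηjk fi fj fk) := by
  have hi0 : 0 ≤ εi := by rcases hεi with rfl | rfl <;> norm_num
  have hj0 : 0 ≤ εj := by rcases hεj with rfl | rfl <;> norm_num
  have hk0 : 0 ≤ εk := by rcases hεk with rfl | rfl <;> norm_num
  have hx := kH_pos hi0 fi
  have hy := kH_pos hj0 fj
  have hz := kH_pos hk0 fk
  have hxi := lt_kH_sq hi0 fi
  have hyj := lt_kH_sq hj0 fj
  have hzk := lt_kH_sq hk0 fk
  unfold QH at hQ
  unfold hHi hHj hHk
  generalize kH εi fi = x at *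
  generalize kH εj fj = y at *
  generalize kH εk fk = z at *
  have hG : 0 < εi * ηjk ^ 2 + εj * ηik ^ 2 + εk * ηij ^ 2 + 2 * ηij * ηik * ηjk -
      εi * εj * εk := by
    rcases lt_or_ge 0 (εj * εk - ηjk ^ 2) with hMi | hMi
    · exact G_pos_of_cofactor_pos hεj hεk hS1jk hS2j hS2k hx hy hz hyj hzk hMi hQ
    rcases lt_or_ge 0 (εi * εk - ηik ^ 2) with hMj | hMj
    · have := G_pos_of_cofactor_pos (a := εj) (p := ηij) (q := ηjk) hεi hεk hS1ik
        (by linarith) (by linarith) hy hx hz hxi hzk hMj (by linarith)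
      linarith
    rcases lt_or_ge 0 (εi * εj - ηij ^ 2) with hMk | hMk
    · have := G_pos_of_cofactor_pos (a := εk) (p := ηik) (q := ηjk) hεi hεj hS1ij
        (by linarith) (by linarith) hz hx hy hxi hyj hMk (by linarith)
      linarith
    exact G_pos_of_cofactors_nonpos hεi hεj hεk hS1ij hS1ik hS1jk hMi hMj hMk
  have hij := second_pos_of_first_neg (a := εi) (b := εj) (c := εk) (p := ηij) (q := ηik)
    (r := ηjk) hk0 (by linarith) (by linarith) (by linarith) hx hy hz (by linarith)
  have hik := second_pos_of_first_neg (a := εi) (b := εk) (c := εj) (p := ηik) (q := ηij)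
    (r := ηjk) hj0 (by linarith) (by linarith) (by linarith) hx hz hy (by linarith)
  have hji := second_pos_of_first_neg (a := εj) (b := εi) (c := εk) (p := ηij) (q := ηjk)
    (r := ηik) hk0 (by linarith) (by linarith) (by linarith) hy hx hz (by linarith)
  have hjk := second_pos_of_first_neg (a := εj) (b := εk) (c := εi) (p := ηjk) (q := ηij)
    (r := ηik) hi0 (by linarith) (by linarith) (by linarith) hy hz hx (by linarith)
  have hki := second_pos_of_first_neg (a := εk) (b := εi) (c := εj) (p := ηik) (q := ηjk)
    (r := ηij) hj0 (by linarith) (by linarith) (by linarith) hz hx hy (by linarith)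
  have hkj := second_pos_of_first_neg (a := εk) (b := εj) (c := εi) (p := ηjk) (q := ηik)
    (r := ηij) hi0 (by linarith) (by linarith) (by linarith) hz hy hx (by linarith)
  rcases lt_or_ge ((εj * εk - ηjk ^ 2) * x + (εk * ηij + ηik * ηjk) * y +
    (εj * ηik + ηij * ηjk) * z) 0 with hi | hi
  · exact Or.inl ⟨hi, by linarith [hij (by linarith)], by linarith [hik (by linarith)]⟩
  rcases lt_or_ge ((εi * εk - ηik ^ 2) * y + (εk * ηij + ηik * ηjk) * x +
    (εi * ηjk + ηij * ηik) * z) 0 with hj | hj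
  · exact Or.inr (Or.inl
      ⟨hj, by linarith [hji (by linarith)], by linarith [hjk (by linarith)]⟩)
  rcases lt_or_ge ((εi * εj - ηij ^ 2) * z + (εj * ηik + ηij * ηjk) * x +
    (εi * ηjk + ηij * ηik) * y) 0 with hk | hk
  · exact Or.inr (Or.inr
      ⟨hk, by linarith [hki (by linarith)], by linarith [hkj (by linarith)]⟩)
  linarith [mul_nonneg hi hx.le, mul_nonneg hj hy.le, mul_nonneg hk hz.le]
end

section
/- Assume (S1) and (S2). Then for all f_i, f_j, f_k ∈ ℝ the determinant of the 3×3 matrix with rows (0, ε_jS_j²C_k + η_jkS_jS_kC_j, ε_kS_k²C_j + η_jkS_jS_kC_k), (ε_iS_i²C_k + η_ikS_iS_kC_i, 0, ε_kS_k²C_i + η_ikS_iS_kC_k), (ε_iS_i²C_j + η_ijS_iS_jC_i, ε_jS_j²C_i + η_ijS_iS_jC_j, 0) is at least 2 S_i²S_j²S_k² C_iC_jC_k (ε_iε_j + η_ij)(ε_iε_k + η_ik)(ε_jε_k + η_jk), and in particular is positive. (Consequently the Jacobian of the hyperbolic edge lengths (l_jk, l_ik, l_ij) with respect to the coordinates (u_i,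 u_j, u_k) with ∂f_q/∂u_q = C_q is nonsingular.) -/
lemma CH_pos {ε : ℝ} (hε : ε = 0 ∨ ε = 1) (f : ℝ) : 0 < CH ε f := by
  unfold CH
  rcases hε with rfl | rfl <;> positivity

lemma weighted_two_mul_le {ε δ : ℝ} (hε : ε = 0 ∨ ε = 1) (hδ : δ = 0 ∨ δ = 1) (x y : ℝ) :
    0 ≤ ε * x ^ 2 + δ * y ^ 2 - 2 * ε * δ * x * y := by
  rcases hε with rfl | rfl <;> rcases hδ with rfl | rfl <;>
    nlinarith [sq_nonneg (x - y), sq_nonneg x, sq_nonneg y]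

theorem stmt18 (εi εj εk ηij ηik ηjk : ℝ)
    (hεi : εi = 0 ∨ εi = 1) (hεj : εj = 0 ∨ εj = 1) (hεk : εk = 0 ∨ εk = 1)
    (hS1ij : 0 < εi * εj + ηij) (hS1ik : 0 < εi * εk + ηik) (hS1jk : 0 < εj * εk + ηjk)
    (hS2i : 0 ≤ εi * ηjk + ηij * ηik) (hS2j : 0 ≤ εj * ηik + ηij * ηjk)
    (hS2k : 0 ≤ εk * ηij + ηik * ηjk) :
    ∀ fi fj fk : ℝ,
      2 * Real.exp fi ^ 2 * Real.exp fj ^ 2 * Real.exp fk ^ 2 *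
          (CH εi fi * CH εj fj * CH εk fk) *
          (εi * εj + ηij) * (εi * εk + ηik) * (εj * εk + ηjk) ≤
        Matrix.det
          !![0,
             εj * Real.exp fj ^ 2 * CH εk fk + ηjk * Real.exp fj * Real.exp fk * CH εj fj,
             εk * Real.exp fk ^ 2 * CH εj fj + ηjk * Real.exp fj * Real.exp fk * CH εk fk;
             εi * Real.exp fi ^ 2 * CH εk fk + ηik * Real.exp fi * Real.exp fk * CH εi fi,
             0,
             εk * Real.exp fk ^ 2 * CH εi fi + ηik * Real.exp fi * Real.exp fk * CH εk fk;
             εi * Real.exp fi ^ 2 * CH εj fj + ηij * Real.exp fi * Real.exp fj * CH εi fi,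
             εj * Real.exp fj ^ 2 * CH εi fi + ηij * Real.exp fi * Real.exp fj * CH εj fj,
             0] ∧
      0 < Matrix.det
          !![0,
             εj * Real.exp fj ^ 2 * CH εk fk + ηjk * Real.exp fj * Real.exp fk * CH εj fj,
             εk * Real.exp fk ^ 2 * CH εj fj + ηjk * Real.exp fj * Real.exp fk * CH εk fk;
             εi * Real.exp fi ^ 2 * CH εk fk + ηik * Real.exp fi * Real.exp fk * CH εi fi,
             0,
             εk * Real.exp fk ^ 2 * CH εi fi + ηik * Real.exp fi * Real.exp fk * CH εk fk;
             εi * Real.exp fi ^ 2 * CH εj fj + ηij * Real.exp fi * Real.exp fj * CH εi fi,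
             εj * Real.exp fj ^ 2 * CH εi fi + ηij * Real.exp fi * Real.exp fj * CH εj fj,
             0] := by
  intro fi fj fk
  have hCi := CH_pos hεi fi
  have hCj := CH_pos hεj fj
  have hCk := CH_pos hεk fk
  have hSi := Real.exp_pos fi
  have hSj := Real.exp_pos fj
  have hSk := Real.exp_pos fk
  generalize CH εi fi = Ci at *
  generalize CH εj fj = Cj at *
  generalize CH εk fk = Ck at *
  generalize Real.exp fi = Si at *
  generalize Real.exp fj = Sj at *
  generalize Real.exp fk = Sk at *
  refine (fun h => ⟨h, lt_of_lt_of_le (by positivity) h⟩) ?_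
  have hDi := weighted_two_mul_le hεj hεk (Sj * Ck) (Sk * Cj)
  have hDj := weighted_two_mul_le hεi hεk (Si * Ck) (Sk * Ci)
  have hDk := weighted_two_mul_le hεi hεj (Si * Cj) (Sj * Ci)
  have hi := mul_nonneg (mul_nonneg (by positivity : 0 ≤ Si * Sj * Sk * (Si * Ci)) hS2i) hDi
  have hj := mul_nonneg (mul_nonneg (by positivity : 0 ≤ Si * Sj * Sk * (Sj * Cj)) hS2j) hDj
  have hk := mul_nonneg (mul_nonneg (by positivity : 0 ≤ Si * Sj * Sk * (Sk * Ck)) hS2k) hDk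
  rw [← sub_nonneg]
  refine (add_nonneg (add_nonneg hi hj) hk).trans_eq ?_
  simp only [Matrix.det_fin_three, Matrix.of_apply, Matrix.cons_val]
  clear * - hεi hεj hεk
  rcases hεi with rfl | rfl <;> rcases hεj with rfl | rfl <;> rcases hεk with rfl | rfl <;> ring
end

section
/- Suppose ε_i = 1, ε_j ∈ {0,1}, and η_ij satisfies ε_iε_j + η_ij > 0 (structure condition (S1) on the edge {ij}). Then there exist positive constants λ (depending only on ε_j and η_ij) and μ (depending only on η_ij) such that for all f_i, f_j ∈ ℝ: λ(C_iC_j + S_iS_j) ≤ C_iC_j + η_ij S_iS_j ≤ μ(C_iC_j + S_iS_j); that is, cosh l_ij is comparable to C_iC_j + S_iS_j. -/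
lemma CH_nonneg (ε f : ℝ) : 0 ≤ CH ε f := Real.sqrt_nonneg _

lemma mul_exp_le_CH {ε : ℝ} (hε : ε = 0 ∨ ε = 1) (f : ℝ) : ε * Real.exp f ≤ CH ε f := by
  apply Real.le_sqrt_of_sq_le
  rcases hε with rfl | rfl <;> simp

theorem stmt19 (εi εj ηij : ℝ) (hεi : εi = 1) (hεj : εj = 0 ∨ εj = 1)
    (hS1 : 0 < εi * εj + ηij) :
    ∃ lam mu : ℝ, 0 < lam ∧ 0 < mu ∧ ∀ fi fj : ℝ,
      lam * (CH εi fi * CH εj fj + Real.exp fi * Real.exp fj) ≤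
          CH εi fi * CH εj fj + ηij * Real.exp fi * Real.exp fj ∧
      CH εi fi * CH εj fj + ηij * Real.exp fi * Real.exp fj ≤
          mu * (CH εi fi * CH εj fj + Real.exp fi * Real.exp fj) := by
  subst hεi
  rw [one_mul] at hS1
  have hεj₀ : 0 ≤ εj := by rcases hεj with rfl | rfl <;> norm_num
  have hεj₁ : εj ≤ 1 := by rcases hεj with rfl | rfl <;> norm_num
  refine ⟨min 1 ((εj + ηij) / 2), 1 + |ηij|, lt_min one_pos (by linarith), by positivity,
    fun fi fj => ?_⟩
  have hS : 0 < Real.exp fi * Real.exp fj := by positivity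
  have hC : 0 ≤ CH 1 fi * CH εj fj := mul_nonneg (CH_nonneg _ _) (CH_nonneg _ _)
  have hSC : εj * (Real.exp fi * Real.exp fj) ≤ CH 1 fi * CH εj fj := by
    have h := mul_le_mul (mul_exp_le_CH (Or.inr rfl) fi) (mul_exp_le_CH hεj fj)
      (by positivity) (CH_nonneg _ _)
    linarith
  have hlam₁ := min_le_left 1 ((εj + ηij) / 2)
  have hlam₂ := min_le_right 1 ((εj + ηij) / 2)
  have hlam₀ : 0 < min 1 ((εj + ηij) / 2) := lt_min one_pos (by linarith)
  rw [mul_assoc ηij]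
  generalize min 1 ((εj + ηij) / 2) = lam at *
  generalize CH 1 fi * CH εj fj = C at *
  generalize Real.exp fi * Real.exp fj = S at *
  constructor
  · have h₁ := mul_le_mul_of_nonneg_left hSC (sub_nonneg.2 hlam₁)
    have h₂ : 0 ≤ (1 - lam) * εj + (ηij - lam) := by
      nlinarith [mul_le_mul_of_nonneg_left hεj₁ hlam₀.le]
    linarith [mul_nonneg h₂ hS.le]
  · linarith [mul_le_mul_of_nonneg_right (le_abs_self ηij) hS.le,
      mul_nonneg (abs_nonneg ηij) hC]
end
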